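/- Suppose the tuning parameter satisfies λ/n ∈ [6σ₀²(|τ₀|+1)log(p/2)/n + t, 0.05·C_min] for a constant t > 0, that |τ₀|·log p / n < 0.23, and that C_min > 120·((|τ₀|+2)·log(p+1)/n)·σ₀². Then for any finite number d of repro samples and any level α ∈ (0,1), the model confidence set Γ̄^τ_α satisfies ℙ_Y(τ₀ ∈ Γ̄^τ_α(Y)) ≥ α − [6·exp(−(n/(18σ₀²))·(0.3·C_min − 36·(log(p+1)/n)·σ₀²)) + 3·exp(−n·t/(3σ₀²)) + exp(−n·d·(0.23 − (|τ₀|·log p + 2)/n))]; in particular, there exists c₂ > 0 such that the deficit below α is o(e^{−c₂n}) as n → ∞. -/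

import Mathlib

open MeasureTheory ProbabilityTheory Matrix Filter
open scoped ENNReal Classical

noncomputable section

namespace ReproSamples

/-- Squared Euclidean norm of a vector in `ℝⁿ`. -/
def sqnorm {n : ℕ} (v : Fin n → ℝ) : ℝ := ∑ i, (v i) ^ 2

/-- The vector `β` with all coordinates outside `τ` set to `0`; this encodes the
vector `β_τ ∈ ℝ^{|τ|}`, so that `X_τ β_τ = X.mulVec (maskOn τ β)`. -/
def maskOn {p : ℕ} (τ : Finset (Fin p)) (β : Fin p → ℝ) : Fin p → ℝ :=
  fun j => if j ∈ τ then β j else 0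

/-- The submatrix `X_τ` of the columns of `X` indexed by `τ`. -/
def subcols {n p : ℕ} (X : Matrix (Fin n) (Fin p) ℝ) (τ : Finset (Fin p)) :
    Matrix (Fin n) {j // j ∈ τ} ℝ :=
  Matrix.of fun i j => X i j.1

/-- The matrix `M (MᵀM)⁻¹ Mᵀ` (orthogonal projection onto the column span of `M`
when `MᵀM` is invertible). -/
def projMat {n : ℕ} {m : Type} [Fintype m] [DecidableEq m]
    (M : Matrix (Fin n) m ℝ) : Matrix (Fin n) (Fin n) ℝ :=
  M * (Mᵀ * M)⁻¹ * Mᵀ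

/-- The projection matrix `H_τ = X_τ (X_τᵀ X_τ)⁻¹ X_τᵀ`. -/
def proj {n p : ℕ} (X : Matrix (Fin n) (Fin p) ℝ) (τ : Finset (Fin p)) :
    Matrix (Fin n) (Fin n) ℝ :=
  projMat (subcols X τ)

/-- Identifiability: `τ₀` is the unique minimizer of `|τ|` over
`{τ : X_τ β_τ = X_{τ₀} β₀ for some β_τ}` (here `β₀` is supported on `τ₀`). -/
def Identifiable {n p : ℕ} (X : Matrix (Fin n) (Fin p) ℝ) (τ₀ : Finset (Fin p))
    (β₀ : Fin p → ℝ) : Prop :=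
  ∀ τ : Finset (Fin p), (∃ β : Fin p → ℝ, X.mulVec (maskOn τ β) = X.mulVec β₀) →
    τ ≠ τ₀ → τ₀.card < τ.card

/-- The separation constant `C_min`. -/
def Cmin {n p : ℕ} (X : Matrix (Fin n) (Fin p) ℝ) (τ₀ : Finset (Fin p))
    (β₀ : Fin p → ℝ) : ℝ :=
  sInf ((fun τ : Finset (Fin p) =>
      sqnorm ((1 - proj X τ).mulVec (X.mulVec β₀)) /
        ((n * max (τ₀ \ τ).card 1 : ℕ) : ℝ)) ''
    {τ : Finset (Fin p) | τ ≠ τ₀ ∧ τ.card ≤ τ₀.card})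

/-- Penalized objective `min_{β_τ, σ} ‖y − X_τ β_τ − σ u*‖² + λ|τ|`. -/
def objPen {n p : ℕ} (X : Matrix (Fin n) (Fin p) ℝ) (lam : ℝ) (y ustar : Fin n → ℝ)
    (τ : Finset (Fin p)) : ℝ :=
  (⨅ bs : (Fin p → ℝ) × ℝ, sqnorm (y - X.mulVec (maskOn τ bs.1) - bs.2 • ustar)) +
    lam * τ.card

/-- Un-penalized objective `min_{β_τ, σ} ‖y − X_τ β_τ − σ u*‖²`. -/
def objFit {n p : ℕ} (X : Matrix (Fin n) (Fin p) ℝ) (y ustar : Fin n → ℝ)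
    (τ : Finset (Fin p)) : ℝ :=
  ⨅ bs : (Fin p → ℝ) × ℝ, sqnorm (y - X.mulVec (maskOn τ bs.1) - bs.2 • ustar)

/-- Standard Gaussian measure `N(0, I_n)` on `ℝⁿ`. -/
def stdGaussian (n : ℕ) : Measure (Fin n → ℝ) :=
  Measure.pi fun _ => gaussianReal 0 1

/-- Joint law of `(U, (U*_1, …, U*_d))`, all i.i.d. `N(0, I_n)`. -/
def jointMeasure (n d : ℕ) : Measure ((Fin n → ℝ) × (Fin d → Fin n → ℝ)) :=
  (stdGaussian n).prod (Measure.pi fun _ : Fin d => stdGaussian n)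

/-- Squared cosine of the angle between two vectors. -/
def rho {n : ℕ} (v w : Fin n → ℝ) : ℝ := (v ⬝ᵥ w) ^ 2 / (sqnorm v * sqnorm w)

/-- `ρ_{τ⊥}(v, w) = ρ((I−H_τ)v, (I−H_τ)w)`. -/
def rhoPerp {n p : ℕ} (X : Matrix (Fin n) (Fin p) ℝ) (τ : Finset (Fin p))
    (v w : Fin n → ℝ) : ℝ :=
  rho ((1 - proj X τ).mulVec v) ((1 - proj X τ).mulVec w)

/-- `ρ(v, τ) = ‖H_τ v‖²/‖v‖²`. -/
def rhoTau {n p : ℕ} (X : Matrix (Fin n) (Fin p) ℝ) (v : Fin n → ℝ)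
    (τ : Finset (Fin p)) : ℝ :=
  sqnorm ((proj X τ).mulVec v) / sqnorm v

/-- The augmented matrix `(X_τ, u)`. -/
def augcols {n p : ℕ} (X : Matrix (Fin n) (Fin p) ℝ) (τ : Finset (Fin p))
    (u : Fin n → ℝ) : Matrix (Fin n) ({j // j ∈ τ} ⊕ Unit) ℝ :=
  Matrix.of fun i j => Sum.elim (fun k : {j // j ∈ τ} => X i k.1) (fun _ => u i) j

/-- The projection matrix `H_{τ,u}` onto the column span of `(X_τ, u)`. -/
def projAug {n p : ℕ} (X : Matrix (Fin n) (Fin p) ℝ) (τ : Finset (Fin p))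
    (u : Fin n → ℝ) : Matrix (Fin n) (Fin n) ℝ :=
  projMat (augcols X τ u)

/-- `γ²_{(u, τ₀)} = 1 − min_{|τ| < |τ₀|} ‖(I−H_{τ,u})X_{τ₀}β₀‖²/‖(I−H_τ)X_{τ₀}β₀‖²`. -/
def gammaSq {n p : ℕ} (X : Matrix (Fin n) (Fin p) ℝ) (τ₀ : Finset (Fin p))
    (β₀ : Fin p → ℝ) (u : Fin n → ℝ) : ℝ :=
  1 - sInf ((fun τ : Finset (Fin p) =>
      sqnorm ((1 - projAug X τ u).mulVec (X.mulVec β₀)) /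
        sqnorm ((1 - proj X τ).mulVec (X.mulVec β₀))) ''
    {τ : Finset (Fin p) | τ.card < τ₀.card})

/-- Residual sum of squares `min_β ‖y − X_τ β‖²`. -/
def rss {n p : ℕ} (X : Matrix (Fin n) (Fin p) ℝ) (y : Fin n → ℝ)
    (τ : Finset (Fin p)) : ℝ :=
  ⨅ β : Fin p → ℝ, sqnorm (y - X.mulVec (maskOn τ β))

/-- `Y*_w = a + b (I−H_τ)u / ‖(I−H_τ)u‖`. -/
def ystar {n p : ℕ} (X : Matrix (Fin n) (Fin p) ℝ) (τ : Finset (Fin p))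
    (a : Fin n → ℝ) (b : ℝ) (u : Fin n → ℝ) : Fin n → ℝ :=
  a + (b / Real.sqrt (sqnorm ((1 - proj X τ).mulVec u))) • ((1 - proj X τ).mulVec u)

/-- `p_{(w,τ)}(τ') = ℙ(T̃(Y*_w, τ) = τ')`. -/
def pfun {n p : ℕ} (X : Matrix (Fin n) (Fin p) ℝ)
    (Tt : (Fin n → ℝ) → Finset (Fin p) → Finset (Fin p))
    (τ : Finset (Fin p)) (a : Fin n → ℝ) (b : ℝ) (τ' : Finset (Fin p)) : ℝ :=
  ((stdGaussian n) {u | Tt (ystar X τ a b u) τ = τ'}).toReal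

/-- `B_α(τ, w) = {τ* : ∑_{τ' : p(τ') ≤ p(τ*)} p(τ') ≥ 1 − α}`. -/
def Bset {n p : ℕ} (X : Matrix (Fin n) (Fin p) ℝ)
    (Tt : (Fin n → ℝ) → Finset (Fin p) → Finset (Fin p)) (α : ℝ)
    (τ : Finset (Fin p)) (a : Fin n → ℝ) (b : ℝ) : Set (Finset (Fin p)) :=
  {τstar | 1 - α ≤
    ∑ τ' ∈ Finset.univ.filter (fun τ' => pfun X Tt τ a b τ' ≤ pfun X Tt τ a b τstar),
      pfun X Tt τ a b τ'}

/-- `τ ∈ Γ̄^τ_α(y)`-membership test: `T̃(y,τ) ∈ B_α(τ, W̃(y,τ))` with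
`W̃(y,τ) = (H_τ y, ‖(I−H_τ)y‖)`. -/
def inCS {n p : ℕ} (X : Matrix (Fin n) (Fin p) ℝ)
    (Tt : (Fin n → ℝ) → Finset (Fin p) → Finset (Fin p)) (α : ℝ)
    (y : Fin n → ℝ) (τ : Finset (Fin p)) : Prop :=
  Tt y τ ∈ Bset X Tt α τ ((proj X τ).mulVec y)
    (Real.sqrt (sqnorm ((1 - proj X τ).mulVec y)))

/-- `O_{τ,Λ}`: orthogonal projection onto the column span of `(I−H_{τ∖Λ}) X_{Λ∩τ}`. -/
def projO {n p : ℕ} (X : Matrix (Fin n) (Fin p) ℝ) (τ Λ : Finset (Fin p)) :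
    Matrix (Fin n) (Fin n) ℝ :=
  projMat ((1 - proj X (τ \ Λ)) * subcols X (Λ ∩ τ))

/-- The nuclear mapping `T̃(y, (β_Λ, τ))` with values in `EReal` (it takes the value
`⊤ = +∞` when `β_i ≠ 0` for some `i ∈ Λ ∖ τ`). -/
def Tnuc {n p : ℕ} (X : Matrix (Fin n) (Fin p) ℝ) (Λ τ : Finset (Fin p))
    (β : Fin p → ℝ) (y : Fin n → ℝ) : EReal :=
  if ∃ i ∈ Λ \ τ, β i ≠ 0 then ⊤
  else if Λ ∩ τ = ∅ then 0
  else ((((y - X.mulVec (maskOn Λ β)) ⬝ᵥ (projO X τ Λ).mulVec (y - X.mulVec (maskOn Λ β))) /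
    (((y - X.mulVec (maskOn Λ β)) ⬝ᵥ (1 - proj X τ).mulVec (y - X.mulVec (maskOn Λ β))) /
      ((n : ℝ) - τ.card)) : ℝ) : EReal)

/-- The statistic `u ↦ (uᵀ O_{τ,Λ} u)/(uᵀ(I−H_τ)u/(n−|τ|))`. -/
def fstat {n p : ℕ} (X : Matrix (Fin n) (Fin p) ℝ) (τ Λ : Finset (Fin p))
    (u : Fin n → ℝ) : ℝ :=
  (u ⬝ᵥ (projO X τ Λ).mulVec u) / ((u ⬝ᵥ (1 - proj X τ).mulVec u) / ((n : ℝ) - τ.card))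

/-- The `α`-quantile `q_α(τ, Λ)` of the law of `fstat` under `N(0, I_n)`. -/
def qant {n p : ℕ} (X : Matrix (Fin n) (Fin p) ℝ) (τ Λ : Finset (Fin p)) (α : ℝ) : ℝ :=
  sInf {x : ℝ | α ≤ (((stdGaussian n).map (fstat X τ Λ)) (Set.Iic x)).toReal}


set_option linter.unusedSectionVars false
section Gauss
variable {F : Type*} [NormedAddCommGroup F] [InnerProductSpace ℝ F] [FiniteDimensional ℝ F]
  [MeasurableSpace F] [BorelSpace F]

/-- radial density -/
def gdens (d : ℕ) (r : ℝ) : ℝ := (2 * Real.pi) ^ (-(d : ℝ) / 2) * Real.exp (-(1 / 2) * r ^ 2)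

lemma gdens_nonneg (d : ℕ) (r : ℝ) : 0 ≤ gdens d r := by unfold gdens; positivity

lemma lintegral_exp_vol (b : ℝ) (hb : 0 < b) :
    ∫⁻ x : F, ENNReal.ofReal (Real.exp (-b * ‖x‖ ^ 2)) =
      ENNReal.ofReal ((Real.pi / b) ^ (Module.finrank ℝ F / 2 : ℝ)) := by
  have h := GaussianFourier.integrable_cexp_neg_mul_sq_norm_add (V := F) (b := (b : ℂ))
    (by simpa using hb) 0 0
  have h' : Integrable (fun x : F => Real.exp (-b * ‖x‖ ^ 2)) := by
    have := h.norm
    simp only [Complex.norm_exp] at this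
    convert this using 3
    simp [← Complex.ofReal_pow]
  rw [← ofReal_integral_eq_lintegral_ofReal h' (Eventually.of_forall fun _ => (Real.exp_pos _).le),
    GaussianFourier.integral_rexp_neg_mul_sq_norm hb]

lemma pow_cancel (d : ℕ) (b : ℝ) (hb : 0 < b) :
    (2 * Real.pi) ^ (-(d : ℝ) / 2) * (Real.pi / b) ^ (d / 2 : ℝ) = (2 * b) ^ (-(d : ℝ) / 2) := by
  have hp := Real.pi_pos
  rw [neg_div, Real.rpow_neg (by positivity), Real.rpow_neg (by positivity),
    ← Real.inv_rpow (by positivity), ← Real.inv_rpow (by positivity),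
    ← Real.mul_rpow (by positivity) (by positivity)]
  congr 1
  field_simp

lemma lintegral_gdens_exp (θ : ℝ) (hθ : θ < 1 / 2) :
    ∫⁻ x : F, ENNReal.ofReal (gdens (Module.finrank ℝ F) ‖x‖) *
        ENNReal.ofReal (Real.exp (θ * ‖x‖ ^ 2)) =
      ENNReal.ofReal ((1 - 2 * θ) ^ (-(Module.finrank ℝ F : ℝ) / 2)) := by
  have h1 : ∀ x : F, ENNReal.ofReal (gdens (Module.finrank ℝ F) ‖x‖) *
        ENNReal.ofReal (Real.exp (θ * ‖x‖ ^ 2)) =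
      ENNReal.ofReal ((2 * Real.pi) ^ (-(Module.finrank ℝ F : ℝ) / 2)) *
        ENNReal.ofReal (Real.exp (-(1 / 2 - θ) * ‖x‖ ^ 2)) := by
    intro x
    rw [← ENNReal.ofReal_mul (gdens_nonneg _ _), ← ENNReal.ofReal_mul (by positivity), gdens,
      mul_assoc, ← Real.exp_add]
    congr 3; ring
  simp_rw [h1]
  rw [lintegral_const_mul _ (by fun_prop), lintegral_exp_vol _ (by linarith),
    ← ENNReal.ofReal_mul (by positivity), pow_cancel _ _ (by linarith)]
  congr 2; ring

lemma gauss_density : ProbabilityTheory.stdGaussian F =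
    (volume : Measure F).withDensity
      (fun x => ENNReal.ofReal (gdens (Module.finrank ℝ F) ‖x‖)) := by
  have hm : Measurable (fun x : F => ENNReal.ofReal (gdens (Module.finrank ℝ F) ‖x‖)) := by
    unfold gdens; fun_prop
  have hfin : IsProbabilityMeasure ((volume : Measure F).withDensity
      (fun x => ENNReal.ofReal (gdens (Module.finrank ℝ F) ‖x‖))) := by
    constructor
    rw [withDensity_apply _ MeasurableSet.univ, Measure.restrict_univ]
    have := lintegral_gdens_exp (F := F) 0 (by norm_num)
    simpa using this
  apply Measure.ext_of_charFun
  ext t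
  rw [charFun_stdGaussian, charFun_apply]
  rw [integral_withDensity_eq_integral_toReal_smul hm (by simp)]
  have h2 : ∀ x : F, (ENNReal.ofReal (gdens (Module.finrank ℝ F) ‖x‖)).toReal •
      Complex.exp ((inner ℝ x t : ℝ) * Complex.I) =
      (((2 * Real.pi) ^ (-(Module.finrank ℝ F : ℝ) / 2) : ℝ) : ℂ) *
        Complex.exp (-((1 / 2 : ℝ) : ℂ) * ‖x‖ ^ 2 + Complex.I * (inner ℝ t x : ℝ)) := by
    intro x
    rw [ENNReal.toReal_ofReal (gdens_nonneg _ _), gdens, Complex.exp_add, real_inner_comm,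
      Complex.real_smul]
    push_cast
    rw [mul_comm Complex.I]; ring
  simp_rw [h2]
  rw [integral_const_mul, GaussianFourier.integral_cexp_neg_mul_sq_norm_add (by norm_num)]
  rw [← mul_assoc]
  have h3 := pow_cancel (Module.finrank ℝ F) (1 / 2) (by norm_num)
  have h4 : ((Real.pi : ℂ) / ((1 / 2 : ℝ) : ℂ)) ^ ((Module.finrank ℝ F : ℂ) / 2) =
      (((Real.pi / (1 / 2)) ^ (Module.finrank ℝ F / 2 : ℝ) : ℝ) : ℂ) := by
    rw [Complex.ofReal_cpow (by positivity)]; push_cast; rfl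
  rw [h4, ← Complex.ofReal_mul, h3]
  norm_num

lemma gauss_exp (θ : ℝ) (hθ : θ < 1 / 2) :
    ∫⁻ x, ENNReal.ofReal (Real.exp (θ * ‖x‖ ^ 2)) ∂(ProbabilityTheory.stdGaussian F) =
      ENNReal.ofReal ((1 - 2 * θ) ^ (-(Module.finrank ℝ F : ℝ) / 2)) := by
  rw [gauss_density, lintegral_withDensity_eq_lintegral_mul _ (by unfold gdens; fun_prop)
    (by fun_prop)]
  exact lintegral_gdens_exp θ hθ

lemma gauss_split (K : Submodule ℝ F) :
    ((ProbabilityTheory.stdGaussian K).prod (ProbabilityTheory.stdGaussian Kᗮ)).map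
      (fun x => (x.1 : F) + (x.2 : F)) = ProbabilityTheory.stdGaussian F := by
  have hK : ∀ (L : Submodule ℝ F) (t : F),
      charFun ((ProbabilityTheory.stdGaussian L).map (fun x : L => (x : F))) t =
      Complex.exp (-‖L.orthogonalProjectionOnto t‖ ^ 2 / 2) := by
    intro L t
    rw [charFun_apply, integral_map (by fun_prop) (by fun_prop),
      ← charFun_stdGaussian (L.orthogonalProjectionOnto t), charFun_apply]
    refine integral_congr_ae (Eventually.of_forall fun x => ?_)
    simp only
    rw [Submodule.inner_orthogonalProjectionOnto_eq_of_mem_left]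
  have h1 : ((ProbabilityTheory.stdGaussian K).prod (ProbabilityTheory.stdGaussian Kᗮ)).map
      (fun x => (x.1 : F) + (x.2 : F)) =
      (((ProbabilityTheory.stdGaussian K).map (fun x : K => (x : F))).prod
        ((ProbabilityTheory.stdGaussian Kᗮ).map (fun x : Kᗮ => (x : F)))).map (fun x => x.1 + x.2) := by
    rw [Measure.map_prod_map _ _ (by fun_prop) (by fun_prop), Measure.map_map (by fun_prop)
      (by fun_prop)]
    rfl
  have i1 : IsProbabilityMeasure ((ProbabilityTheory.stdGaussian K).map (fun x : K => (x : F))) :=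
    Measure.isProbabilityMeasure_map (by fun_prop)
  have i2 : IsProbabilityMeasure ((ProbabilityTheory.stdGaussian Kᗮ).map (fun x : Kᗮ => (x : F))) :=
    Measure.isProbabilityMeasure_map (by fun_prop)
  rw [h1]
  have i3 := Measure.isProbabilityMeasure_map (μ := (((ProbabilityTheory.stdGaussian K).map (fun x : K => (x : F))).prod
        ((ProbabilityTheory.stdGaussian Kᗮ).map (fun x : Kᗮ => (x : F))))) (f := fun x => x.1 + x.2) (by fun_prop)
  apply Measure.ext_of_charFun
  rw [charFun_map_add_prod_eq_mul]
  ext t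
  rw [Pi.mul_apply, hK, hK, charFun_stdGaussian, ← Complex.exp_add,
    ← Complex.ofReal_pow ‖t‖, K.norm_sq_eq_add_norm_sq_projection t]
  congr 1
  push_cast
  ring

lemma starProj_add (K : Submodule ℝ F) (x : K) (y : Kᗮ) :
    K.starProjection ((x : F) + y) = x := by
  rw [map_add, Submodule.starProjection_mem_subspace_eq_self,
    (Submodule.starProjection_apply_eq_zero_iff (K := K)).2 y.2, add_zero]

lemma starProj_add' (K : Submodule ℝ F) (x : K) (y : Kᗮ) :
    Kᗮ.starProjection ((x : F) + y) = y := by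
  rw [map_add, Submodule.starProjection_mem_subspace_eq_self,
    (Submodule.starProjection_apply_eq_zero_iff (K := Kᗮ)).2
      (K.le_orthogonal_orthogonal x.2), zero_add]

lemma gauss_lintegral_mul (K : Submodule ℝ F) (f g : F → ℝ≥0∞) (hf : Measurable f)
    (hg : Measurable g) :
    ∫⁻ u, f (K.starProjection u) * g (Kᗮ.starProjection u) ∂(ProbabilityTheory.stdGaussian F) =
    (∫⁻ x, f x ∂(ProbabilityTheory.stdGaussian K)) *
      (∫⁻ x, g x ∂(ProbabilityTheory.stdGaussian Kᗮ)) := by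
  rw [← gauss_split K, lintegral_map (by fun_prop) (by fun_prop)]
  simp_rw [starProj_add, starProj_add']
  exact lintegral_prod_mul (f := fun x : K => f x) (g := fun x : Kᗮ => g x) (by fun_prop) (by fun_prop)

lemma gauss_proj_exp (K : Submodule ℝ F) (θ : ℝ) (hθ : θ < 1 / 2) :
    ∫⁻ u, ENNReal.ofReal (Real.exp (θ * ‖K.starProjection u‖ ^ 2))
      ∂(ProbabilityTheory.stdGaussian F) =
      ENNReal.ofReal ((1 - 2 * θ) ^ (-(Module.finrank ℝ K : ℝ) / 2)) := by
  have := gauss_lintegral_mul K (fun x => ENNReal.ofReal (Real.exp (θ * ‖x‖ ^ 2))) (fun _ => 1)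
    (by fun_prop) (by fun_prop)
  simp only [mul_one, lintegral_one, measure_univ] at this
  rw [this, ← gauss_exp θ hθ]
  rfl

lemma gauss_tail (K : Submodule ℝ F) (r : ℕ) (hr : Module.finrank ℝ K ≤ r) (a : ℝ) :
    ProbabilityTheory.stdGaussian F {u | a ≤ ‖K.starProjection u‖ ^ 2} ≤
      ENNReal.ofReal (Real.sqrt 3 ^ r * Real.exp (-a / 3)) := by
  have h := gauss_proj_exp K (1 / 3) (by norm_num)
  have h1 : ProbabilityTheory.stdGaussian F {u | a ≤ ‖K.starProjection u‖ ^ 2} ≤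
      ProbabilityTheory.stdGaussian F {u | ENNReal.ofReal (Real.exp (a / 3)) ≤
        ENNReal.ofReal (Real.exp (1 / 3 * ‖K.starProjection u‖ ^ 2))} := by
    apply measure_mono
    intro u hu
    apply ENNReal.ofReal_le_ofReal
    apply Real.exp_le_exp.2
    have : a ≤ ‖K.starProjection u‖ ^ 2 := hu
    linarith
  refine h1.trans ?_
  have h2 := meas_ge_le_lintegral_div (μ := ProbabilityTheory.stdGaussian F)
    (f := fun u => ENNReal.ofReal (Real.exp (1 / 3 * ‖K.starProjection u‖ ^ 2)))
    (by fun_prop) (ε := ENNReal.ofReal (Real.exp (a / 3))) (by simp [Real.exp_pos]) (by simp)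
  refine h2.trans ?_
  rw [h, ← ENNReal.ofReal_div_of_pos (Real.exp_pos _)]
  apply ENNReal.ofReal_le_ofReal
  rw [neg_div 3 a, Real.exp_neg, div_eq_mul_inv]
  gcongr
  rw [Real.sqrt_eq_rpow, ← Real.rpow_natCast, ← Real.rpow_mul (by norm_num)]
  norm_num
  rw [neg_div, Real.rpow_neg (by norm_num), show (1 / 3 : ℝ) = 3⁻¹ by norm_num,
    Real.inv_rpow (by norm_num), inv_inv]
  apply Real.rpow_le_rpow_of_exponent_le (by norm_num)
  have : (Module.finrank ℝ K : ℝ) ≤ r := by exact_mod_cast hr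
  linarith

lemma gauss_cos (M N : Submodule ℝ F) (hMN : M ≤ N) (hM : Module.finrank ℝ M ≤ 1) (r : ℕ)
    (hr : r ≤ Module.finrank ℝ Nᗮ) :
    ProbabilityTheory.stdGaussian F
      {u | 0.6 * ‖Nᗮ.starProjection u‖ ^ 2 ≤ 0.4 * ‖M.starProjection u‖ ^ 2} ≤
      ENNReal.ofReal (Real.sqrt 5 * (2.2 : ℝ) ^ (-(r : ℝ) / 2)) := by
  have hMN' : ∀ u, M.starProjection (N.starProjection u) = M.starProjection u := by
    intro u
    have := Submodule.starProjection_comp_starProjection_of_le hMN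
    exact DFunLike.congr_fun this u
  have h1 := gauss_lintegral_mul N (fun x => ENNReal.ofReal (Real.exp (0.4 * ‖M.starProjection x‖ ^ 2)))
    (fun x => ENNReal.ofReal (Real.exp (-0.6 * ‖x‖ ^ 2))) (by fun_prop) (by fun_prop)
  simp only [hMN'] at h1
  have h2 := gauss_lintegral_mul N (fun x => ENNReal.ofReal (Real.exp (0.4 * ‖M.starProjection x‖ ^ 2)))
    (fun x => 1) (by fun_prop) (by fun_prop)
  simp only [hMN', mul_one, lintegral_one, measure_univ] at h2
  rw [gauss_proj_exp M 0.4 (by norm_num)] at h2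
  rw [← h2] at h1
  have h3 := gauss_exp (F := Nᗮ) (-0.6) (by norm_num)
  have h3' : ∫⁻ x : Nᗮ, ENNReal.ofReal (Real.exp (-0.6 * ‖(x : F)‖ ^ 2))
      ∂(ProbabilityTheory.stdGaussian Nᗮ) = _ := h3
  rw [h3'] at h1
  have h4 := meas_ge_le_lintegral_div (μ := ProbabilityTheory.stdGaussian F)
    (f := fun u => ENNReal.ofReal (Real.exp (0.4 * ‖M.starProjection u‖ ^ 2)) *
      ENNReal.ofReal (Real.exp (-0.6 * ‖Nᗮ.starProjection u‖ ^ 2)))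
    (by fun_prop) (ε := 1) (by simp) (by simp)
  rw [h1] at h4
  refine le_trans (measure_mono ?_) (h4.trans ?_)
  · intro u hu
    have hu' : 0.6 * ‖Nᗮ.starProjection u‖ ^ 2 ≤ 0.4 * ‖M.starProjection u‖ ^ 2 := hu
    rw [Set.mem_ofPred_eq]
    rw [← ENNReal.ofReal_mul (Real.exp_pos _).le, ← Real.exp_add, ENNReal.one_le_ofReal,
      Real.one_le_exp_iff]
    linarith
  · rw [div_one, ← ENNReal.ofReal_mul (by positivity)]
    apply ENNReal.ofReal_le_ofReal
    gcongr
    · norm_num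
      rw [Real.sqrt_eq_rpow, neg_div, Real.rpow_neg (by norm_num), one_div, Real.inv_rpow (by norm_num), inv_inv]
      apply Real.rpow_le_rpow_of_exponent_le (by norm_num)
      have : (Module.finrank ℝ M : ℝ) ≤ 1 := by exact_mod_cast hM
      linarith
    · norm_num
      have : (r : ℝ) ≤ (Module.finrank ℝ Nᗮ : ℝ)  := by exact_mod_cast hr
      linarith

end Gauss

set_option linter.unusedSectionVars false
section Polar
variable {F : Type*} [NormedAddCommGroup F] [InnerProductSpace ℝ F] [FiniteDimensional ℝ F]
  [MeasurableSpace F] [BorelSpace F]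

lemma polar_lintegral [Nontrivial F] (f : F → ℝ≥0∞) (hf : Measurable f) :
    ∫⁻ x, f x ∂(ProbabilityTheory.stdGaussian F) =
      ∫⁻ θ, ∫⁻ r, ENNReal.ofReal (gdens (Module.finrank ℝ F) (r : ℝ)) * f ((r : ℝ) • (θ : F))
        ∂(Measure.volumeIoiPow (Module.finrank ℝ F - 1)) ∂((volume : Measure F).toSphere) := by
  have hg : Measurable (fun x : F => ENNReal.ofReal (gdens (Module.finrank ℝ F) ‖x‖)) := by
    unfold gdens; fun_prop
  have hg1 : Measurable (fun r : ℝ => ENNReal.ofReal (gdens (Module.finrank ℝ F) r)) := by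
    unfold gdens; fun_prop
  rw [gauss_density, lintegral_withDensity_eq_lintegral_mul _ hg hf,
    ← restrict_compl_singleton (μ := (volume : Measure F)) (0 : F),
    ← lintegral_subtype_comap (measurableSet_singleton _).compl]
  have h := (volume : Measure F).measurePreserving_homeomorphUnitSphereProd
  set G : (Metric.sphere (0 : F) 1) × (Set.Ioi (0 : ℝ)) → ℝ≥0∞ := fun z =>
    ENNReal.ofReal (gdens (Module.finrank ℝ F) (z.2 : ℝ)) * f ((z.2 : ℝ) • (z.1 : F)) with hG
  have hGm : Measurable G := by
    refine Measurable.mul (hg1.comp (by fun_prop)) (hf.comp (by fun_prop))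
  have h2 := h.lintegral_comp hGm
  rw [lintegral_prod _ hGm.aemeasurable] at h2
  rw [restrict_compl_singleton, ← h2]
  apply lintegral_congr
  intro x
  have hx : (x : F) ≠ 0 := x.2
  have hx' : ‖(x : F)‖ ≠ 0 := norm_ne_zero_iff.2 hx
  simp [hG, smul_smul, hx']

lemma polar_law [Nontrivial F] (f : F → ℝ≥0∞) (hf : Measurable f) :
    ∫⁻ g, ∫⁻ g', f ((‖g‖ / ‖g'‖) • g') ∂(ProbabilityTheory.stdGaussian F)
      ∂(ProbabilityTheory.stdGaussian F) = ∫⁻ x, f x ∂(ProbabilityTheory.stdGaussian F) := by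
  set σ := (volume : Measure F).toSphere
  set ν := Measure.volumeIoiPow (Module.finrank ℝ F - 1)
  have hg1 : Measurable (fun r : Set.Ioi (0 : ℝ) =>
      ENNReal.ofReal (gdens (Module.finrank ℝ F) r)) := by
    unfold gdens; fun_prop
  have h1 := polar_lintegral (F := F) (fun _ => 1) measurable_const
  simp only [mul_one, lintegral_one, measure_univ, lintegral_const] at h1
  set c := ∫⁻ r : Set.Ioi (0 : ℝ), ENNReal.ofReal (gdens (Module.finrank ℝ F) (r : ℝ)) ∂ν with hc
  have h2 : ∀ g : F, ∫⁻ g', f ((‖g‖ / ‖g'‖) • g') ∂(ProbabilityTheory.stdGaussian F) =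
      c * ∫⁻ θ : Metric.sphere (0 : F) 1, f (‖g‖ • (θ : F)) ∂σ := by
    intro g
    rw [polar_lintegral _ (by fun_prop)]
    rw [← lintegral_const_mul _ (by fun_prop)]
    apply lintegral_congr
    intro θ
    rw [hc, ← lintegral_mul_const _ hg1]
    apply lintegral_congr
    intro r
    have hr : (0 : ℝ) < r := r.2
    have hr' : |(r : ℝ)| = r := abs_of_pos hr
    have hr2 : (r : ℝ) ≠ 0 := hr.ne'
    simp [norm_smul, smul_smul, hr', hr2]
  have hm : Measurable (fun ρ : ℝ => ∫⁻ θ : Metric.sphere (0 : F) 1, f (ρ • (θ : F)) ∂σ) := by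
    apply Measurable.lintegral_prod_right'
      (f := fun z : ℝ × Metric.sphere (0 : F) 1 => f (z.1 • (z.2 : F)))
    fun_prop
  simp_rw [h2]
  rw [lintegral_const_mul _ (by exact hm.comp measurable_norm)]
  rw [polar_lintegral _ (by exact hm.comp measurable_norm), polar_lintegral f hf]
  have h3 : ∀ θ : Metric.sphere (0 : F) 1, ∀ r : Set.Ioi (0 : ℝ), ‖(r : ℝ) • (θ : F)‖ = r := by
    intro θ r
    have hr : (0 : ℝ) < r := r.2
    simp [norm_smul, abs_of_pos hr]
  simp_rw [h3]
  rw [lintegral_const, mul_comm, mul_assoc, mul_comm _ c, ← h1, mul_one]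
  rw [lintegral_lintegral_swap]
  · apply lintegral_congr
    intro r
    rw [lintegral_const_mul _ (by fun_prop)]
  · apply Measurable.aemeasurable
    apply Measurable.mul (by exact hg1.comp measurable_snd)
    fun_prop

lemma law_identity (K : Submodule ℝ F) (hK : Nontrivial Kᗮ) (f : F → ℝ≥0∞) (hf : Measurable f) :
    ∫⁻ u, ∫⁻ v, f (K.starProjection u +
        (‖Kᗮ.starProjection u‖ / ‖Kᗮ.starProjection v‖) • Kᗮ.starProjection v)
      ∂(ProbabilityTheory.stdGaussian F) ∂(ProbabilityTheory.stdGaussian F) =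
    ∫⁻ x, f x ∂(ProbabilityTheory.stdGaussian F) := by
  have hm : Measurable fun (x : F × F) => f (K.starProjection x.1 +
        (‖Kᗮ.starProjection x.1‖ / ‖Kᗮ.starProjection x.2‖) • Kᗮ.starProjection x.2) := by
    fun_prop
  have h1 : ∀ u : F, ∫⁻ v, f (K.starProjection u +
        (‖Kᗮ.starProjection u‖ / ‖Kᗮ.starProjection v‖) • Kᗮ.starProjection v)
        ∂(ProbabilityTheory.stdGaussian F) = 
        ∫⁻ v : Kᗮ, f (K.starProjection u + (‖Kᗮ.starProjection u‖ / ‖v‖) • (v : F))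
        ∂(ProbabilityTheory.stdGaussian Kᗮ) := by
    intro u
    rw [← gauss_split K, lintegral_map (by fun_prop) (by fun_prop)]
    simp_rw [starProj_add']
    rw [lintegral_prod _ (by fun_prop)]
    simp
  simp_rw [h1]
  rw [← gauss_split K, lintegral_map, lintegral_map hf (by fun_prop), lintegral_prod,
    lintegral_prod]
  · apply lintegral_congr
    intro x
    simp_rw [starProj_add, starProj_add']
    have := polar_law (F := Kᗮ) (fun y => f ((x : F) + (y : F))) (by fun_prop)
    simpa using this
  · fun_prop
  · apply Measurable.aemeasurable
    apply Measurable.lintegral_prod_right'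
      (f := fun z : ((K × Kᗮ) × Kᗮ) => f (K.starProjection ((z.1.1 : F) + z.1.2) +
        (‖Kᗮ.starProjection ((z.1.1 : F) + z.1.2)‖ / ‖z.2‖) • (z.2 : F)))
    fun_prop
  · apply Measurable.lintegral_prod_right'
      (f := fun z : (F × Kᗮ) => f (K.starProjection z.1 +
        (‖Kᗮ.starProjection z.1‖ / ‖z.2‖) • (z.2 : F)))
    fun_prop
  · fun_prop

lemma gauss_null (K : Submodule ℝ F) (hK : Nontrivial K) :
    ProbabilityTheory.stdGaussian F {u | K.starProjection u = 0} = 0 := by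
  have hz : (ProbabilityTheory.stdGaussian K) {0} = 0 := by
    rw [gauss_density]
    exact withDensity_absolutelyContinuous _ _ (measure_singleton 0)
  have hms : MeasurableSet {u : F | K.starProjection u = 0} :=
    measurableSet_eq_fun (by fun_prop) (by fun_prop)
  rw [← gauss_split K, Measure.map_apply (by fun_prop) hms]
  have : (fun x : K × Kᗮ => (x.1 : F) + (x.2 : F)) ⁻¹' {u | K.starProjection u = 0} =
      {0} ×ˢ Set.univ := by
    ext x
    simp [starProj_add, -map_add]
  rw [this, Measure.prod_prod, hz, zero_mul]

end Polar

section Bridge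
variable {n p : ℕ}

/-- Euclidean vector. -/
abbrev lp (v : Fin n → ℝ) : EuclideanSpace ℝ (Fin n) := WithLp.toLp 2 v

lemma sqnorm_eq (v : Fin n → ℝ) : sqnorm v = ‖lp v‖ ^ 2 := by
  rw [EuclideanSpace.real_norm_sq_eq]; rfl

/-- column span -/
def Sp (X : Matrix (Fin n) (Fin p) ℝ) (τ : Finset (Fin p)) :
    Submodule ℝ (EuclideanSpace ℝ (Fin n)) :=
  Submodule.span ℝ ((fun j => lp (fun i => X i j)) '' (τ : Set (Fin p)))

lemma Sp_mono (X : Matrix (Fin n) (Fin p) ℝ) {τ τ' : Finset (Fin p)} (h : τ ⊆ τ') :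
    Sp X τ ≤ Sp X τ' := Submodule.span_mono (Set.image_mono (by exact_mod_cast h))

lemma Sp_union (X : Matrix (Fin n) (Fin p) ℝ) (τ τ' : Finset (Fin p)) :
    Sp X (τ ∪ τ') = Sp X τ ⊔ Sp X τ' := by
  unfold Sp; rw [Finset.coe_union, Set.image_union, Submodule.span_union]

lemma finrank_Sp (X : Matrix (Fin n) (Fin p) ℝ) (τ : Finset (Fin p)) :
    Module.finrank ℝ (Sp X τ) ≤ τ.card := by
  unfold Sp
  rw [← Finset.coe_image]
  exact (finrank_span_finset_le_card _).trans Finset.card_image_le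

lemma mulVec_mask (X : Matrix (Fin n) (Fin p) ℝ) (τ : Finset (Fin p)) (β : Fin p → ℝ) :
    lp (X.mulVec (maskOn τ β)) = ∑ j ∈ τ, β j • lp (fun i => X i j) := by
  ext i
  simp only [Matrix.mulVec, dotProduct, maskOn, WithLp.ofLp_sum, Finset.sum_apply]
  simp [mul_comm]

lemma mem_Sp (X : Matrix (Fin n) (Fin p) ℝ) (τ : Finset (Fin p)) (x : EuclideanSpace ℝ (Fin n)) :
    x ∈ Sp X τ ↔ ∃ β : Fin p → ℝ, lp (X.mulVec (maskOn τ β)) = x := by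
  simp_rw [mulVec_mask]
  constructor
  · intro h
    unfold Sp at h
    obtain ⟨f, hf⟩ := (Submodule.mem_span_image_finset_iff_exists_fun ℝ).1 h
    refine ⟨fun j => if hj : j ∈ τ then f ⟨j, hj⟩ else 0, ?_⟩
    rw [← hf, ← Finset.sum_coe_sort]
    apply Finset.sum_congr rfl
    intro j _
    simp
  · rintro ⟨β, rfl⟩
    exact Submodule.sum_mem _ fun j hj => Submodule.smul_mem _ _
      (Submodule.subset_span ⟨j, hj, rfl⟩)

lemma proj_eq (X : Matrix (Fin n) (Fin p) ℝ) (τ : Finset (Fin p))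
    (h : IsUnit ((subcols X τ)ᵀ * subcols X τ).det) (v : Fin n → ℝ) :
    lp ((proj X τ).mulVec v) = (Sp X τ).starProjection (lp v) := by
  set M := subcols X τ with hM
  symm
  apply Submodule.eq_starProjection_of_mem_of_inner_eq_zero
  · have : (proj X τ).mulVec v = M.mulVec (((Mᵀ * M)⁻¹ * Mᵀ).mulVec v) := by
      rw [proj, projMat, Matrix.mulVec_mulVec, Matrix.mul_assoc]
    rw [this]
    set w := ((Mᵀ * M)⁻¹ * Mᵀ).mulVec v
    have h2 : lp (M.mulVec w) = ∑ j : {j // j ∈ τ}, w j • lp (fun i => X i j.1) := by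
      ext i
      simp only [Matrix.mulVec, dotProduct, WithLp.ofLp_sum, Finset.sum_apply]
      simp [hM, subcols, mul_comm]
    rw [h2]
    exact Submodule.sum_mem _ fun j _ => Submodule.smul_mem _ _
      (Submodule.subset_span ⟨j.1, j.2, rfl⟩)
  · intro w hw
    have h0 : Mᵀ.mulVec (v - (proj X τ).mulVec v) = 0 := by
      rw [Matrix.mulVec_sub, proj, projMat, ← hM, Matrix.mulVec_mulVec,
        ← Matrix.mul_assoc, ← Matrix.mul_assoc, Matrix.mul_nonsing_inv _ h, Matrix.one_mul,
        sub_self]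
    refine Submodule.span_induction ?_ ?_ ?_ ?_ hw
    · rintro _ ⟨j, hj, rfl⟩
      have := congrFun h0 ⟨j, hj⟩
      rw [← WithLp.toLp_sub]
      simp only [EuclideanSpace.inner_eq_star_dotProduct]
      simpa [Matrix.mulVec, dotProduct, hM, subcols] using this
    · simp
    · intro x y _ _ hx hy
      rw [inner_add_right, hx, hy, add_zero]
    · intro a x _ hx
      rw [inner_smul_right, hx, mul_zero]

lemma proj_eq' (X : Matrix (Fin n) (Fin p) ℝ) (τ : Finset (Fin p))
    (h : IsUnit ((subcols X τ)ᵀ * subcols X τ).det) (v : Fin n → ℝ) :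
    lp ((1 - proj X τ).mulVec v) = (Sp X τ)ᗮ.starProjection (lp v) := by
  rw [Submodule.starProjection_orthogonal_val, ← proj_eq X τ h,
    Matrix.sub_mulVec, Matrix.one_mulVec, lp, WithLp.toLp_sub]

/-- augmented span -/
def Vs (X : Matrix (Fin n) (Fin p) ℝ) (τ : Finset (Fin p)) (u : EuclideanSpace ℝ (Fin n)) :
    Submodule ℝ (EuclideanSpace ℝ (Fin n)) := Sp X τ ⊔ Submodule.span ℝ {u}

lemma mem_Vs (X : Matrix (Fin n) (Fin p) ℝ) (τ : Finset (Fin p)) (u x : EuclideanSpace ℝ (Fin n)) :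
    x ∈ Vs X τ u ↔ ∃ (β : Fin p → ℝ) (c : ℝ), lp (X.mulVec (maskOn τ β)) + c • u = x := by
  unfold Vs
  rw [Submodule.mem_sup]
  constructor
  · rintro ⟨y, hy, z, hz, rfl⟩
    obtain ⟨β, rfl⟩ := (mem_Sp X τ y).1 hy
    obtain ⟨c, rfl⟩ := Submodule.mem_span_singleton.1 hz
    exact ⟨β, c, rfl⟩
  · rintro ⟨β, c, rfl⟩
    exact ⟨_, (mem_Sp X τ _).2 ⟨β, rfl⟩, _, Submodule.mem_span_singleton.2 ⟨c, rfl⟩, rfl⟩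

lemma perp_le {F : Type*} [NormedAddCommGroup F] [InnerProductSpace ℝ F] [FiniteDimensional ℝ F]
    (K : Submodule ℝ F) (y x : F) (hx : x ∈ K) : ‖Kᗮ.starProjection y‖ ≤ ‖y - x‖ := by
  have : Kᗮ.starProjection y = Kᗮ.starProjection (y - x) := by
    rw [map_sub, (Submodule.starProjection_apply_eq_zero_iff (K := Kᗮ)).2
      (K.le_orthogonal_orthogonal hx), sub_zero]
  rw [this]
  exact Submodule.norm_starProjection_apply_le _ _

lemma objPen_eq (X : Matrix (Fin n) (Fin p) ℝ) (lam : ℝ) (y u : Fin n → ℝ) (τ : Finset (Fin p)) :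
    objPen X lam y u τ = ‖(Vs X τ (lp u))ᗮ.starProjection (lp y)‖ ^ 2 + lam * τ.card := by
  unfold objPen
  congr 1
  set V := Vs X τ (lp u)
  have key : ∀ bs : (Fin p → ℝ) × ℝ, lp (y - X.mulVec (maskOn τ bs.1) - bs.2 • u) =
      lp y - (lp (X.mulVec (maskOn τ bs.1)) + bs.2 • lp u) := by
    intro bs; simp [lp, sub_sub]
  apply le_antisymm
  · have hm := Submodule.starProjection_apply_mem V (lp y)
    obtain ⟨β, c, h⟩ := (mem_Vs X τ _ _).1 hm
    refine (ciInf_le ⟨0, ?_⟩ (β, c)).trans ?_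
    · rintro _ ⟨bs, rfl⟩; simp only [sqnorm_eq]; positivity
    · rw [sqnorm_eq, key, h, Submodule.starProjection_orthogonal_val]
  · apply le_ciInf
    intro bs
    rw [sqnorm_eq, key]
    gcongr
    exact perp_le V _ _ ((mem_Vs X τ _ _).2 ⟨_, _, rfl⟩)

lemma stdG_map (n : ℕ) : (stdGaussian n).map (WithLp.toLp 2) =
    ProbabilityTheory.stdGaussian (EuclideanSpace ℝ (Fin n)) := map_pi_eq_stdGaussian

lemma stdG_map' (n : ℕ) : (ProbabilityTheory.stdGaussian (EuclideanSpace ℝ (Fin n))).map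
    WithLp.ofLp = stdGaussian n := by
  rw [← stdG_map, Measure.map_map (by fun_prop) (by fun_prop)]
  exact Measure.map_id

instance (n : ℕ) : IsProbabilityMeasure (stdGaussian n) := by unfold stdGaussian; infer_instance

lemma stdG_apply (s : Set (EuclideanSpace ℝ (Fin n))) :
    stdGaussian n {u | lp u ∈ s} = ProbabilityTheory.stdGaussian (EuclideanSpace ℝ (Fin n)) s := by
  rw [← stdG_map]
  exact ((MeasurableEquiv.toLp 2 (Fin n → ℝ)).map_apply s).symm

lemma stdG_lintegral (f : EuclideanSpace ℝ (Fin n) → ℝ≥0∞) :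
    ∫⁻ u, f (lp u) ∂(stdGaussian n) =
      ∫⁻ u, f u ∂(ProbabilityTheory.stdGaussian (EuclideanSpace ℝ (Fin n))) := by
  rw [← stdG_map]
  exact (lintegral_map_equiv f (MeasurableEquiv.toLp 2 (Fin n → ℝ))).symm

end Bridge

section PartI
variable {n p : ℕ}

lemma conf_level (X : Matrix (Fin n) (Fin p) ℝ)
    (Tt : (Fin n → ℝ) → Finset (Fin p) → Finset (Fin p)) (α : ℝ) 
    (τ : Finset (Fin p)) (a : Fin n → ℝ) (b : ℝ) :
    stdGaussian n {u | Tt (ystar X τ a b u) τ ∉ Bset X Tt α τ a b} ≤ ENNReal.ofReal (1 - α) := by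
  set Bad : Finset (Finset (Fin p)) := Finset.univ.filter (fun τ' => τ' ∉ Bset X Tt α τ a b)
    with hBad
  have hsub : {u | Tt (ystar X τ a b u) τ ∉ Bset X Tt α τ a b} ⊆
      ⋃ τ' ∈ Bad, {u | Tt (ystar X τ a b u) τ = τ'} := by
    intro u hu
    simp only [Set.mem_iUnion]
    exact ⟨_, Finset.mem_filter.2 ⟨Finset.mem_univ _, hu⟩, rfl⟩
  have hpos : ∀ τ', 0 ≤ pfun X Tt τ a b τ' := fun τ' => ENNReal.toReal_nonneg
  have h1 : stdGaussian n {u | Tt (ystar X τ a b u) τ ∉ Bset X Tt α τ a b} ≤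
      ENNReal.ofReal (∑ τ' ∈ Bad, pfun X Tt τ a b τ') := by
    refine (measure_mono hsub).trans ((measure_biUnion_finset_le _ _).trans ?_)
    rw [ENNReal.ofReal_sum_of_nonneg (fun i _ => hpos i)]
    apply Finset.sum_le_sum
    intro i _
    unfold pfun
    rw [ENNReal.ofReal_toReal (measure_ne_top _ _)]
  refine h1.trans ?_
  rcases Bad.eq_empty_or_nonempty with h0 | hne
  · rw [h0]; simp
  · apply ENNReal.ofReal_le_ofReal
    obtain ⟨τs, hτs, hmax⟩ := Finset.exists_max_image Bad (pfun X Tt τ a b) hne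
    have h2 : τs ∉ Bset X Tt α τ a b := (Finset.mem_filter.1 hτs).2
    unfold Bset at h2
    rw [Set.mem_ofPred_eq, not_le] at h2
    refine le_trans ?_ h2.le
    apply Finset.sum_le_sum_of_subset_of_nonneg
    · intro τ' h'
      exact Finset.mem_filter.2 ⟨Finset.mem_univ _, hmax τ' h'⟩
    · intro i _ _; exact hpos i

lemma lp_inj {v w : Fin n → ℝ} (h : lp v = lp w) : v = w := WithLp.toLp_injective 2 h

lemma partI (X : Matrix (Fin n) (Fin p) ℝ) (τ₀ : Finset (Fin p)) (β₀ : Fin p → ℝ)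
    (hβsupp : ∀ j ∉ τ₀, β₀ j = 0) (σ₀ : ℝ) (hσ₀ : 0 < σ₀)
    (hG : IsUnit ((subcols X τ₀)ᵀ * subcols X τ₀).det) (hn : τ₀.card < n)
    (α : ℝ) (hα : α ∈ Set.Ioo (0 : ℝ) 1)
    (Tt : (Fin n → ℝ) → Finset (Fin p) → Finset (Fin p)) :
    ENNReal.ofReal α ≤ stdGaussian n {U | inCS X Tt α (X.mulVec β₀ + σ₀ • U) τ₀} := by
  set E2 := {U | inCS X Tt α (X.mulVec β₀ + σ₀ • U) τ₀} with hE2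
  set M := toMeasurable (stdGaussian n) E2 with hM
  have hMm : MeasurableSet M := measurableSet_toMeasurable _ _
  have hEM : E2 ⊆ M := subset_toMeasurable _ _
  rw [← measure_toMeasurable E2, ← hM]
  set K := Sp X τ₀ with hK
  have hmK : lp (X.mulVec β₀) ∈ K := by
    rw [mem_Sp]
    refine ⟨β₀, ?_⟩
    congr 2
    ext j
    unfold maskOn
    split_ifs with h
    · rfl
    · exact (hβsupp j h).symm
  set m := lp (X.mulVec β₀) with hm
  have hnt : Nontrivial Kᗮ := by
    apply Module.nontrivial_of_finrank_pos (R := ℝ)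
    have h1 := Submodule.finrank_add_finrank_orthogonal K
    have h2 : Module.finrank ℝ K ≤ _ := finrank_Sp X τ₀
    rw [finrank_euclideanSpace_fin] at h1
    omega
  have hPm : K.starProjection m = m := Submodule.starProjection_eq_self_iff.2 hmK
  have hPm' : Kᗮ.starProjection m = 0 := by
    rw [Submodule.starProjection_orthogonal_val, hPm, sub_self]
  have hKK : ∀ x, K.starProjection (K.starProjection x) = K.starProjection x := fun x =>
    Submodule.starProjection_eq_self_iff.2 (Submodule.starProjection_apply_mem _ _)
  have hKK' : ∀ x, Kᗮ.starProjection (Kᗮ.starProjection x) = Kᗮ.starProjection x := fun x =>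
    Submodule.starProjection_eq_self_iff.2 (Submodule.starProjection_apply_mem _ _)
  have hKc : ∀ x, K.starProjection (Kᗮ.starProjection x) = 0 := fun x =>
    (Submodule.starProjection_apply_eq_zero_iff (K := K)).2 (Submodule.starProjection_apply_mem _ _)
  have hcK : ∀ x, Kᗮ.starProjection (K.starProjection x) = 0 := fun x =>
    (Submodule.starProjection_apply_eq_zero_iff (K := Kᗮ)).2
      (K.le_orthogonal_orthogonal (Submodule.starProjection_apply_mem _ _))
  -- complement
  have hcomp : stdGaussian n Mᶜ ≤ ENNReal.ofReal (1 - α) := by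
    have hset : Mᶜ = {u : Fin n → ℝ | lp u ∈ (WithLp.ofLp ⁻¹' Mᶜ : Set (EuclideanSpace ℝ (Fin n)))} := by
      ext u; simp
    have hms : MeasurableSet (WithLp.ofLp ⁻¹' Mᶜ : Set (EuclideanSpace ℝ (Fin n))) :=
      hMm.compl.preimage (by fun_prop)
    rw [hset, stdG_apply, ← lintegral_indicator_one hms,
      ← law_identity K hnt _ (measurable_one.indicator hms)]
    calc _ ≤ ∫⁻ u : EuclideanSpace ℝ (Fin n), ENNReal.ofReal (1 - α)
          ∂(ProbabilityTheory.stdGaussian (EuclideanSpace ℝ (Fin n))) := ?_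
      _ = _ := by simp
    apply lintegral_mono
    intro u
    simp only
    set Φ := fun v => K.starProjection u +
        (‖Kᗮ.starProjection u‖ / ‖Kᗮ.starProjection v‖) • Kᗮ.starProjection v with hΦ
    have hΦm : Measurable Φ := by fun_prop
    have : ∀ v, (WithLp.ofLp ⁻¹' Mᶜ : Set (EuclideanSpace ℝ (Fin n))).indicator (1 : EuclideanSpace ℝ (Fin n) → ℝ≥0∞) (Φ v) =
      (Φ ⁻¹' (WithLp.ofLp ⁻¹' Mᶜ)).indicator (1 : EuclideanSpace ℝ (Fin n) → ℝ≥0∞) v := fun v => rfl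
    change ∫⁻ v, (WithLp.ofLp ⁻¹' Mᶜ : Set (EuclideanSpace ℝ (Fin n))).indicator
      (1 : EuclideanSpace ℝ (Fin n) → ℝ≥0∞) (Φ v) ∂_ ≤ _
    simp_rw [this]
    rw [lintegral_indicator_one (hms.preimage hΦm)]
    set a := (proj X τ₀).mulVec (X.mulVec β₀ + σ₀ • u.ofLp) with ha
    set b := Real.sqrt (sqnorm ((1 - proj X τ₀).mulVec (X.mulVec β₀ + σ₀ • u.ofLp))) with hb
    have hlpu : lp (X.mulVec β₀ + σ₀ • u.ofLp) = m + σ₀ • u := by simp [hm, lp]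
    have ha' : lp a = m + σ₀ • K.starProjection u := by
      rw [ha, proj_eq X τ₀ hG, hlpu, map_add, map_smul, ← hK, hPm]
    have hb' : b = σ₀ * ‖Kᗮ.starProjection u‖ := by
      rw [hb, sqnorm_eq, proj_eq' X τ₀ hG, hlpu, map_add, map_smul, ← hK, hPm', zero_add,
        Real.sqrt_sq (norm_nonneg _), norm_smul, Real.norm_eq_abs, abs_of_pos hσ₀]
    have hsub : Φ ⁻¹' (WithLp.ofLp ⁻¹' Mᶜ) ⊆ {v | Kᗮ.starProjection v = 0} ∪
        {v | v.ofLp ∈ {w | Tt (ystar X τ₀ a b w) τ₀ ∉ Bset X Tt α τ₀ a b}} := by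
      intro v hv
      by_cases hv0 : Kᗮ.starProjection v = 0
      · exact Or.inl hv0
      right
      have hv1 : (Φ v).ofLp ∉ E2 := fun h => hv (hEM h)
      have hnv : ‖Kᗮ.starProjection v‖ ≠ 0 := norm_ne_zero_iff.2 hv0
      rw [hE2, Set.mem_ofPred_eq] at hv1
      unfold inCS at hv1
      have hlpΦ : lp (X.mulVec β₀ + σ₀ • (Φ v).ofLp) = m + σ₀ • Φ v := by simp [hm, lp]
      have e1 : (proj X τ₀).mulVec (X.mulVec β₀ + σ₀ • (Φ v).ofLp) = a := by
        apply lp_inj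
        rw [ha', proj_eq X τ₀ hG, hlpΦ, map_add, map_smul, ← hK, hPm]
        simp only [hΦ, map_add, map_smul, hKK, hKc, smul_zero, add_zero]
      have e2 : Real.sqrt (sqnorm ((1 - proj X τ₀).mulVec (X.mulVec β₀ + σ₀ • (Φ v).ofLp))) = b := by
        rw [hb', sqnorm_eq, proj_eq' X τ₀ hG, hlpΦ, map_add, map_smul, ← hK, hPm', zero_add,
          Real.sqrt_sq (norm_nonneg _), norm_smul, Real.norm_eq_abs, abs_of_pos hσ₀]
        simp only [hΦ, map_add, map_smul, hKK', hcK, zero_add, norm_smul, norm_div, norm_norm]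
        field_simp
      have e3 : X.mulVec β₀ + σ₀ • (Φ v).ofLp = ystar X τ₀ a b v.ofLp := by
        apply lp_inj
        rw [hlpΦ]
        unfold ystar
        rw [lp, WithLp.toLp_add, WithLp.toLp_smul]
        change _ = lp a + _ • lp _
        rw [ha', proj_eq' X τ₀ hG, sqnorm_eq, proj_eq' X τ₀ hG, Real.sqrt_sq (norm_nonneg _), hb']
        simp only [hΦ, smul_add, smul_smul, ← hK]
        rw [add_assoc, mul_div_assoc]
      rw [e1, e2, e3] at hv1
      exact hv1
    refine (measure_mono hsub).trans ((measure_union_le _ _).trans ?_)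
    rw [gauss_null Kᗮ hnt, zero_add, ← stdG_apply]
    exact conf_level X Tt α τ₀ a b
  have h1 : (1 : ℝ≥0∞) ≤ stdGaussian n M + ENNReal.ofReal (1 - α) := by
    calc (1 : ℝ≥0∞) = stdGaussian n M + stdGaussian n Mᶜ := by
          rw [measure_add_measure_compl hMm, measure_univ]
      _ ≤ _ := by gcongr
  have h2 : (1 : ℝ≥0∞) = ENNReal.ofReal α + ENNReal.ofReal (1 - α) := by
    rw [← ENNReal.ofReal_add hα.1.le (by linarith [hα.2])]; simp
  rw [h2] at h1
  exact (ENNReal.add_le_add_iff_right ENNReal.ofReal_ne_top).1 h1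

end PartI

section Geom
variable {F : Type*} [NormedAddCommGroup F] [InnerProductSpace ℝ F] [FiniteDimensional ℝ F]

lemma pyth_perp (A B : Submodule ℝ F) (h : A ≤ B) (z : F) :
    ‖Aᗮ.starProjection z‖ ^ 2 = ‖Bᗮ.starProjection z‖ ^ 2 +
      ‖(B ⊓ Aᗮ).starProjection z‖ ^ 2 := by
  have hB : ∀ w ∈ B, inner ℝ (z - B.starProjection z) w = 0 :=
    fun w hw => B.starProjection_inner_eq_zero z w hw
  have hA : ∀ w ∈ A, inner ℝ (z - A.starProjection z) w = 0 :=
    fun w hw => A.starProjection_inner_eq_zero z w hw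
  have hmem : B.starProjection z - A.starProjection z ∈ B ⊓ Aᗮ := by
    refine ⟨B.sub_mem (B.starProjection_apply_mem z) (h (A.starProjection_apply_mem z)), ?_⟩
    refine (Submodule.mem_orthogonal' _ _).2 ?_
    intro w hw
    have : B.starProjection z - A.starProjection z =
      (z - A.starProjection z) - (z - B.starProjection z) := by abel
    rw [this, inner_sub_left, hA w hw, hB w (h hw), sub_zero]
  have hR : (B ⊓ Aᗮ).starProjection z = B.starProjection z - A.starProjection z := by
    apply Submodule.eq_starProjection_of_mem_of_inner_eq_zero hmem
    intro w hw
    have e : z - (B.starProjection z - A.starProjection z) =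
      (z - B.starProjection z) + A.starProjection z := by abel
    rw [e, inner_add_left, hB w hw.1, zero_add]
    exact (Submodule.mem_orthogonal _ _).1 hw.2 _ (A.starProjection_apply_mem z)
  rw [hR, Submodule.starProjection_orthogonal_val, Submodule.starProjection_orthogonal_val]
  have e : z - A.starProjection z = (z - B.starProjection z) +
    (B.starProjection z - A.starProjection z) := by abel
  rw [e, norm_add_sq_real, hB _ hmem.1]
  ring

lemma norm_proj_mono (A B : Submodule ℝ F) (h : A ≤ B) (z : F) :
    ‖A.starProjection z‖ ≤ ‖B.starProjection z‖ := by
  have := DFunLike.congr_fun (Submodule.starProjection_comp_starProjection_of_le h) z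
  rw [← this]
  exact Submodule.norm_starProjection_apply_le _ _

lemma finrank_R (A C B : Submodule ℝ F) (hB : B = A ⊔ C) (k : ℕ) (hk : Module.finrank ℝ C ≤ k) :
    Module.finrank ℝ (B ⊓ Aᗮ : Submodule ℝ F) ≤ k := by
  have h1 := Submodule.finrank_add_inf_finrank_orthogonal (K₁ := A) (K₂ := B) (by rw [hB]; exact le_sup_left)
  have h2 := Submodule.finrank_add_le_finrank_add_finrank A C
  rw [← hB] at h2
  rw [inf_comm]
  omega

lemma inner_le_proj (m U : F) :
    |inner ℝ m U| ≤ ‖m‖ * ‖(Submodule.span ℝ {m}).starProjection U‖ := by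
  have h : inner ℝ (U - (Submodule.span ℝ {m}).starProjection U) m = 0 :=
    Submodule.starProjection_inner_eq_zero _ _ (Submodule.mem_span_singleton_self m)
  rw [inner_sub_left, sub_eq_zero] at h
  rw [real_inner_comm, h, mul_comm]
  exact abs_real_inner_le_norm _ _

lemma perp_of_mem (A : Submodule ℝ F) (m : F) (hm : m ∈ A) : Aᗮ.starProjection m = 0 :=
  (Submodule.starProjection_apply_eq_zero_iff (K := Aᗮ)).2 (A.le_orthogonal_orthogonal hm)

lemma caseA_det (V0 V W : Submodule ℝ F) (h0 : V0 ≤ W) (hV : V ≤ W) (m U : F) (hm : m ∈ V0)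
    (σ a : ℝ)
    (hbad : ‖Vᗮ.starProjection (m + σ • U)‖ ^ 2 + a ≤ ‖V0ᗮ.starProjection (m + σ • U)‖ ^ 2) :
    a ≤ σ ^ 2 * ‖(W ⊓ V0ᗮ).starProjection U‖ ^ 2 := by
  have h1 := pyth_perp V W hV (m + σ • U)
  have h2 := pyth_perp V0 W h0 U
  rw [map_add V0ᗮ.starProjection, map_smul V0ᗮ.starProjection, perp_of_mem V0 m hm, zero_add,
    norm_smul, mul_pow, Real.norm_eq_abs, sq_abs] at hbad
  rw [map_add Wᗮ.starProjection, map_smul Wᗮ.starProjection, perp_of_mem W m (h0 hm), zero_add,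
    norm_smul, mul_pow, Real.norm_eq_abs, sq_abs] at h1
  rw [h2] at hbad
  nlinarith [sq_nonneg ‖(W ⊓ Vᗮ).starProjection (m + σ • U)‖]

lemma caseB_det (V0 V W : Submodule ℝ F) (h0 : V0 ≤ W) (hV : V ≤ W) (m U : F) (hm : m ∈ V0)
    (σ a Q : ℝ) (hσ : 0 < σ) (hQ : 0 < Q) (hA : 0.4 * Q ≤ ‖Vᗮ.starProjection m‖ ^ 2)
    (ha : -(0.05 * Q) ≤ a)
    (hbad : ‖Vᗮ.starProjection (m + σ • U)‖ ^ 2 + a ≤ ‖V0ᗮ.starProjection (m + σ • U)‖ ^ 2) :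
    Q / 20 ≤ σ ^ 2 * ‖(Submodule.span ℝ {Vᗮ.starProjection m}).starProjection U‖ ^ 2 ∨
    Q / 20 ≤ σ ^ 2 * ‖(W ⊓ V0ᗮ).starProjection U‖ ^ 2 := by
  by_contra hcon
  push Not at hcon
  obtain ⟨c1, c2⟩ := hcon
  have h1 := pyth_perp V W hV U
  have h2 := pyth_perp V0 W h0 U
  have e1 : ‖Vᗮ.starProjection (m + σ • U)‖ ^ 2 = ‖Vᗮ.starProjection m‖ ^ 2 +
      2 * σ * inner ℝ (Vᗮ.starProjection m) U + σ ^ 2 * ‖Vᗮ.starProjection U‖ ^ 2 := by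
    have : inner ℝ (Vᗮ.starProjection m) (Vᗮ.starProjection U) =
        inner ℝ (Vᗮ.starProjection m) U := by
      rw [Submodule.inner_starProjection_left_eq_right, ← Submodule.inner_starProjection_left_eq_right,
        ← Submodule.inner_starProjection_left_eq_right]
      rw [Submodule.starProjection_eq_self_iff.2 (Submodule.starProjection_apply_mem _ _)]
    rw [map_add, map_smul, norm_add_sq_real, inner_smul_right, this, norm_smul, mul_pow,
      Real.norm_eq_abs, sq_abs]
    ring
  have h3 := inner_le_proj (Vᗮ.starProjection m) U
  rw [map_add V0ᗮ.starProjection, map_smul V0ᗮ.starProjection, perp_of_mem V0 m hm, zero_add,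
    norm_smul, mul_pow, Real.norm_eq_abs, sq_abs, e1] at hbad
  set A := ‖Vᗮ.starProjection m‖ with hAdef
  set s := ‖(Submodule.span ℝ {Vᗮ.starProjection m}).starProjection U‖ with hs
  have hA0 : 0 ≤ A := norm_nonneg _
  have hs0 : 0 ≤ s := norm_nonneg _
  have h4 : σ * s ≤ 0.3536 * A := by
    apply abs_le_of_sq_le_sq' _ (by positivity) |>.2
    nlinarith
  have h5 := (abs_le.1 h3).1
  rw [h2] at hbad
  have h6 : -(σ * (A * s)) ≤ σ * inner ℝ (Vᗮ.starProjection m) U := by nlinarith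
  have h7 : A * (σ * s) ≤ A * (0.3536 * A) := mul_le_mul_of_nonneg_left h4 hA0
  have h8 : σ ^ 2 * ‖Wᗮ.starProjection U‖ ^ 2 ≤ σ ^ 2 * ‖Vᗮ.starProjection U‖ ^ 2 := by
    apply mul_le_mul_of_nonneg_left _ (sq_nonneg σ)
    nlinarith [sq_nonneg ‖(W ⊓ Vᗮ).starProjection U‖]
  nlinarith

lemma good_det (S : Submodule ℝ F) (m u : F)
    (hG : (inner ℝ (Sᗮ.starProjection m) u) ^ 2 ≤
      0.6 * ‖Sᗮ.starProjection m‖ ^ 2 * ‖Sᗮ.starProjection u‖ ^ 2) :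
    0.4 * ‖Sᗮ.starProjection m‖ ^ 2 ≤ ‖(S ⊔ Submodule.span ℝ {u})ᗮ.starProjection m‖ ^ 2 := by
  set V := S ⊔ Submodule.span ℝ {u} with hV
  have hv := V.starProjection_apply_mem m
  obtain ⟨s, hs, z, hz, hsz⟩ := Submodule.mem_sup.1 hv
  obtain ⟨c, rfl⟩ := Submodule.mem_span_singleton.1 hz
  rw [Submodule.starProjection_orthogonal_val (K := V), ← hsz]
  have h1 : ‖Sᗮ.starProjection (m - (s + c • u))‖ ^ 2 ≤ ‖m - (s + c • u)‖ ^ 2 := by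
    gcongr
    exact Submodule.norm_starProjection_apply_le _ _
  refine le_trans ?_ h1
  have this : inner ℝ (Sᗮ.starProjection m) (Sᗮ.starProjection u) =
      inner ℝ (Sᗮ.starProjection m) u := by
    rw [Submodule.inner_starProjection_left_eq_right, ← Submodule.inner_starProjection_left_eq_right,
      ← Submodule.inner_starProjection_left_eq_right]
    rw [Submodule.starProjection_eq_self_iff.2 (Submodule.starProjection_apply_mem _ _)]
  rw [map_sub, map_add, map_smul, perp_of_mem S s hs, zero_add, norm_sub_sq_real,
    inner_smul_right, this, norm_smul, mul_pow, Real.norm_eq_abs, sq_abs]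
  set i := inner ℝ (Sᗮ.starProjection m) u
  set M := ‖Sᗮ.starProjection m‖ ^ 2
  set N := ‖Sᗮ.starProjection u‖ ^ 2 with hN
  have hM0 : 0 ≤ M := sq_nonneg _
  have hN0 : 0 ≤ N := sq_nonneg _
  rcases hN0.eq_or_lt with h | h
  · rw [← h] at hG ⊢
    have : i = 0 := by nlinarith
    rw [this]; nlinarith
  · by_contra hc
    push Not at hc
    nlinarith [sq_nonneg (c * N - i), mul_lt_mul_of_pos_left hc h]

variable [MeasurableSpace F] [BorelSpace F]

lemma good_prob (S : Submodule ℝ F) (m : F) (s : ℕ) (hS : Module.finrank ℝ S ≤ s) :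
    ProbabilityTheory.stdGaussian F {u | 0.6 * ‖Sᗮ.starProjection m‖ ^ 2 *
      ‖Sᗮ.starProjection u‖ ^ 2 < (inner ℝ (Sᗮ.starProjection m) u) ^ 2} ≤
      ENNReal.ofReal (Real.sqrt 5 * (2.2 : ℝ) ^
        (-((Module.finrank ℝ F - s - 1 : ℕ) : ℝ) / 2)) := by
  set m' := Sᗮ.starProjection m with hm'
  set M := Submodule.span ℝ {m'} with hM
  set N := S ⊔ M with hN
  have hM1 : Module.finrank ℝ M ≤ 1 := (finrank_span_le_card _).trans (by simp)
  have hN1 : Module.finrank ℝ N ≤ s + 1 :=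
    (Submodule.finrank_add_le_finrank_add_finrank S M).trans (by omega)
  have hN2 := Submodule.finrank_add_finrank_orthogonal N
  refine le_trans (measure_mono ?_) (gauss_cos M N le_sup_right hM1 _ (by omega))
  intro u hu
  rw [Set.mem_ofPred_eq] at hu ⊢
  have h1 := pyth_perp S N le_sup_left u
  have hMR : M ≤ N ⊓ Sᗮ := by
    refine le_inf le_sup_right ?_
    rw [hM, Submodule.span_singleton_le_iff_mem]
    exact Submodule.starProjection_apply_mem _ _
  have h2 := norm_proj_mono _ _ hMR u
  have h3 := inner_le_proj m' u
  have h4 : (inner ℝ m' u) ^ 2 ≤ ‖m'‖ ^ 2 * ‖M.starProjection u‖ ^ 2 := by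
    rw [← mul_pow, ← sq_abs (inner ℝ m' u)]
    gcongr
  have h5 : 0 < ‖m'‖ ^ 2 := by
    by_contra h
    have h0 : ‖m'‖ ^ 2 = 0 := le_antisymm (not_lt.1 h) (sq_nonneg _)
    rw [h0] at hu h4
    nlinarith
  have h6 : 0.6 * ‖Sᗮ.starProjection u‖ ^ 2 < ‖M.starProjection u‖ ^ 2 := by
    by_contra h
    push Not at h
    nlinarith
  have h7 : ‖M.starProjection u‖ ^ 2 ≤ ‖(N ⊓ Sᗮ).starProjection u‖ ^ 2 := by gcongr
  nlinarith

end Geom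

section Comb

lemma card_models (p s : ℕ) :
    (Finset.univ.filter (fun τ : Finset (Fin p) => τ.card ≤ s)).card ≤ (p + 1) ^ s := by
  have h : (Finset.univ.filter (fun τ : Finset (Fin p) => τ.card ≤ s)) ⊆
      Finset.image (fun f : Fin s → Option (Fin p) =>
        Finset.univ.filter (fun j => ∃ i, f i = some j)) Finset.univ := by
    intro τ hτ
    have hτ' : τ.card ≤ s := (Finset.mem_filter.1 hτ).2
    refine Finset.mem_image.2 ⟨fun i => if h : (i : ℕ) < τ.card then
      some (τ.equivFin.symm ⟨i, h⟩).1 else none, Finset.mem_univ _, ?_⟩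
    ext j
    simp only [Finset.mem_filter, Finset.mem_univ, true_and]
    constructor
    · rintro ⟨i, hi⟩
      split_ifs at hi with h
      rw [Option.some.injEq] at hi
      rw [← hi]
      exact (τ.equivFin.symm ⟨i, h⟩).2
    · intro hj
      refine ⟨⟨τ.equivFin ⟨j, hj⟩, lt_of_lt_of_le (Fin.is_lt _) hτ'⟩, ?_⟩
      simp
  refine (Finset.card_le_card h).trans (Finset.card_image_le.trans ?_)
  simp

lemma card_l1 (p : ℕ) (τ₀ : Finset (Fin p)) :
    (Finset.univ.filter (fun τ : Finset (Fin p) => τ.card ≤ τ₀.card ∧ (τ₀ \ τ).card = 1)).card ≤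
      τ₀.card * (p + 1) := by
  have h : (Finset.univ.filter (fun τ : Finset (Fin p) =>
      τ.card ≤ τ₀.card ∧ (τ₀ \ τ).card = 1)) ⊆
      Finset.image (fun f : Fin p × Option (Fin p) =>
        (τ₀.erase f.1) ∪ f.2.toFinset) (τ₀ ×ˢ Finset.univ) := by
    intro τ hτ
    obtain ⟨hc, h1⟩ := (Finset.mem_filter.1 hτ).2
    obtain ⟨i, hi⟩ := Finset.card_eq_one.1 h1
    have hi0 : i ∈ τ₀ \ τ := by rw [hi]; simp
    have e1 : τ₀ ∩ τ = τ₀.erase i := by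
      ext j
      have : j ∈ τ₀ \ τ ↔ j = i := by rw [hi]; simp
      simp only [Finset.mem_sdiff, Finset.mem_inter, Finset.mem_erase] at this ⊢
      tauto
    have e2 : τ = (τ₀.erase i) ∪ (τ \ τ₀) := by
      rw [← e1]; ext j; simp only [Finset.mem_union, Finset.mem_inter, Finset.mem_sdiff]; tauto
    have hk : (τ \ τ₀).card ≤ 1 := by
      have a1 := Finset.card_sdiff_add_card_inter τ τ₀
      have a2 := Finset.card_sdiff_add_card_inter τ₀ τ
      rw [Finset.inter_comm] at a2
      omega
    rcases Nat.le_one_iff_eq_zero_or_eq_one.1 hk with h0 | h1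
    · refine Finset.mem_image.2 ⟨(i, none), by simp [(Finset.mem_sdiff.1 hi0).1], ?_⟩
      rw [Finset.card_eq_zero.1 h0] at e2
      rw [e2]; simp
    · obtain ⟨j, hj⟩ := Finset.card_eq_one.1 h1
      refine Finset.mem_image.2 ⟨(i, some j), by simp [(Finset.mem_sdiff.1 hi0).1], ?_⟩
      rw [hj] at e2
      conv_rhs => rw [e2]
      simp
  refine (Finset.card_le_card h).trans (Finset.card_image_le.trans ?_)
  simp [Finset.card_product]

lemma sum_w (p : ℕ) (τ₀ : Finset (Fin p)) (w : ℝ) (hw0 : 0 ≤ w) (hw1 : w ≤ 1) :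
    ∑ τ ∈ Finset.univ.filter (fun τ : Finset (Fin p) => τ ≠ τ₀ ∧ τ.card ≤ τ₀.card),
      w ^ (τ₀ \ τ).card ≤ (τ₀.card * (p + 1) : ℕ) * w + ((p + 1) ^ τ₀.card : ℕ) * w ^ 2 := by
  set T1 := Finset.univ.filter (fun τ : Finset (Fin p) => τ.card ≤ τ₀.card ∧ (τ₀ \ τ).card = 1)
  set T2 := Finset.univ.filter (fun τ : Finset (Fin p) => τ.card ≤ τ₀.card)
  have hle : ∀ τ ∈ Finset.univ.filter (fun τ : Finset (Fin p) => τ ≠ τ₀ ∧ τ.card ≤ τ₀.card),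
      w ^ (τ₀ \ τ).card ≤ (if (τ₀ \ τ).card = 1 then w else 0) + w ^ 2 := by
    intro τ hτ
    obtain ⟨hne, hc⟩ := (Finset.mem_filter.1 hτ).2
    have hpos : (τ₀ \ τ).card ≠ 0 := by
      intro h
      have hsub : τ₀ ⊆ τ := Finset.sdiff_eq_empty_iff_subset.1 (Finset.card_eq_zero.1 h)
      exact hne (Finset.eq_of_subset_of_card_le hsub hc).symm
    split_ifs with h1
    · rw [h1, pow_one]; nlinarith [sq_nonneg w]
    · rw [zero_add]
      exact pow_le_pow_of_le_one hw0 hw1 (by omega)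
  refine (Finset.sum_le_sum hle).trans ?_
  rw [Finset.sum_add_distrib]
  gcongr
  · rw [← Finset.sum_filter, Finset.sum_const, nsmul_eq_mul]
    gcongr
    refine le_trans (Finset.card_le_card ?_) (card_l1 p τ₀)
    intro τ; simp only [Finset.mem_filter]; tauto
  · rw [Finset.sum_const, nsmul_eq_mul]
    gcongr
    refine le_trans (Finset.card_le_card ?_) (card_models p τ₀.card)
    intro τ; simp only [Finset.mem_filter]; tauto

lemma sum_K (p : ℕ) (τ₀ : Finset (Fin p)) (c : ℝ) :
    ∑ K ∈ (Finset.univ \ τ₀).powerset.erase ∅, c ^ K.card = (1 + c) ^ (p - τ₀.card) - 1 := by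
  have h := Finset.sum_pow_mul_eq_add_pow c 1 (Finset.univ \ τ₀)
  simp only [one_pow, mul_one] at h
  have h2 := Finset.sum_erase_add (Finset.univ \ τ₀).powerset (fun K => c ^ K.card)
    (Finset.empty_mem_powerset _)
  have h3 : (Finset.univ \ τ₀).card = p - τ₀.card := by
    rw [Finset.card_sdiff_of_subset (Finset.subset_univ _)]; simp
  rw [h3] at h
  simp only [Finset.card_empty, pow_zero] at h2
  rw [add_comm 1 c]
  linarith

lemma sqrt3_le : Real.sqrt 3 ≤ 1.7321 := by
  rw [Real.sqrt_le_left (by norm_num)]; norm_num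

lemma num_A (p : ℕ) (hp : 2 ≤ p) :
    (1 + Real.sqrt 3 * (2 / (p : ℝ)) ^ 2) ^ (p - 1) ≤ 4 := by
  have h3 := sqrt3_le
  have h30 := Real.sqrt_nonneg 3
  obtain rfl | rfl | h4 : p = 2 ∨ p = 3 ∨ 4 ≤ p := by omega
  · norm_num; linarith
  · norm_num; nlinarith
  · have h1 : (1 + Real.sqrt 3 * (2 / (p : ℝ)) ^ 2) ^ (p - 1) ≤
        Real.exp (Real.sqrt 3 * (2 / (p : ℝ)) ^ 2) ^ (p - 1) := by
      gcongr
      rw [add_comm]; exact Real.add_one_le_exp _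
    refine h1.trans ?_
    rw [← Real.exp_nat_mul]
    have hp4 : (4 : ℝ) ≤ p := by exact_mod_cast h4
    have hcast : ((p - 1 : ℕ) : ℝ) = p - 1 := by
      rw [Nat.cast_sub (by omega)]; simp
    rw [hcast]
    have h2 : ((p : ℝ) - 1) * (2 / (p : ℝ)) ^ 2 ≤ 3 / 4 := by
      rw [div_pow, mul_div_assoc', div_le_div_iff₀ (by positivity) (by norm_num)]
      nlinarith
    have h5 : ((p : ℝ) - 1) * (Real.sqrt 3 * (2 / (p : ℝ)) ^ 2) ≤ 2 * Real.log 2 := by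
      have := Real.log_two_gt_d9
      nlinarith
    calc _ ≤ Real.exp (2 * Real.log 2) := Real.exp_le_exp.2 h5
      _ = 4 := by rw [two_mul, Real.exp_add, Real.exp_log (by norm_num)]; norm_num

lemma num_B (p s : ℕ) (hs : 1 ≤ s) (hsp : s ≤ p) (z : ℝ) (hz0 : 0 ≤ z)
    (hz : z ≤ Real.exp (-(2 * ((s : ℝ) + 2) * Real.log ((p : ℝ) + 1)))) :
    Real.sqrt 3 * z ≤ 1 ∧ 
    2 * ((s * (p + 1) : ℕ) * (Real.sqrt 3 * z) + ((p + 1) ^ s : ℕ) * (Real.sqrt 3 * z) ^ 2) ≤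
      6 * ((p : ℝ) + 1) ^ 2 * z := by
  have h3 := sqrt3_le
  have h30 := Real.sqrt_nonneg 3
  have hs1 : (1 : ℝ) ≤ s := by exact_mod_cast hs
  have hsp1 : (s : ℝ) ≤ p := by exact_mod_cast hsp
  have hp1 : (1 : ℝ) ≤ p := hs1.trans hsp1
  have hL : 0 ≤ Real.log ((p : ℝ) + 1) := Real.log_nonneg (by linarith)
  have e1 : ((p : ℝ) + 1) ^ s = Real.exp (s * Real.log ((p : ℝ) + 1)) := by
    rw [Real.exp_nat_mul, Real.exp_log (by linarith)]
  have k1 : ((p : ℝ) + 1) ^ s * z ≤ 1 := by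
    rw [e1]
    calc _ ≤ _ := mul_le_mul_of_nonneg_left hz (Real.exp_pos _).le
      _ = Real.exp (s * Real.log ((p : ℝ) + 1) - (2 * ((s : ℝ) + 2) * Real.log ((p : ℝ) + 1))) := by
        rw [← Real.exp_add]; ring_nf
      _ ≤ 1 := by
        rw [Real.exp_le_one_iff]; nlinarith
  have k2 : z ≤ 1 / 2 := by
    have : (2 : ℝ) ≤ ((p : ℝ) + 1) ^ s := by
      calc (2 : ℝ) ≤ (p : ℝ) + 1 := by linarith
        _ = ((p : ℝ) + 1) ^ 1 := by ring
        _ ≤ _ := pow_le_pow_right₀ (by linarith) hs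
    nlinarith
  refine ⟨by nlinarith, ?_⟩
  push_cast
  have q1 : Real.sqrt 3 * z ≤ 1.7321 * z := by gcongr
  have sq3 : Real.sqrt 3 ^ 2 = 3 := Real.sq_sqrt (by norm_num)
  have q2 : ((p : ℝ) + 1) ^ s * (Real.sqrt 3 * z) ^ 2 ≤ 3 * z := by
    rw [mul_pow, sq3]
    nlinarith
  have q3 : (s : ℝ) * (p + 1) * (Real.sqrt 3 * z) ≤ ((p : ℝ) * (p + 1)) * (1.7321 * z) := by
    gcongr
  have q4 : 0 ≤ ((p : ℝ) - 1) * z := by nlinarith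
  have q5 : 0 ≤ ((p : ℝ) - 1) * p * z := by nlinarith
  nlinarith

lemma num_G (p s n : ℕ) (hs : 1 ≤ s) (hsp : s ≤ p)
    (h : (s : ℝ) * Real.log p + 2 < 0.23 * n) :
    s < n ∧ (((p + 1) ^ s : ℕ) : ℝ) * (Real.sqrt 5 * (2.2 : ℝ) ^ (-((n - s - 1 : ℕ) : ℝ) / 2)) ≤
      Real.exp (2 + s * Real.log p - 0.23 * n) := by
  have hs1 : (1 : ℝ) ≤ s := by exact_mod_cast hs
  have hsp1 : (s : ℝ) ≤ p := by exact_mod_cast hsp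
  have hp1 : (1 : ℝ) ≤ p := hs1.trans hsp1
  have hn : 0.59 * ((s : ℝ) + 1) ≤ s * Real.log p + 2 := by
    rcases Nat.lt_or_ge p 2 with h2 | h2
    · have : p = 1 := by omega
      subst this
      have : s = 1 := by omega
      subst this
      norm_num
    · have : Real.log 2 ≤ Real.log p := Real.log_le_log (by norm_num) (by exact_mod_cast h2)
      have := Real.log_two_gt_d9
      nlinarith
  have hn2 : 0.38 * ((s : ℝ) + 1) ≤ 0.15 * n := by nlinarith
  have hsn : (s : ℝ) + 1 ≤ n := by linarith
  have hsn' : s + 1 ≤ n := by exact_mod_cast hsn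
  refine ⟨by omega, ?_⟩
  have hcast : ((n - s - 1 : ℕ) : ℝ) = n - s - 1 := by
    rw [Nat.cast_sub (by omega), Nat.cast_sub (by omega)]; simp
  rw [hcast]
  have b1 : (((p + 1) ^ s : ℕ) : ℝ) ≤ Real.exp (1 + s * Real.log p) := by
    push_cast
    have : (p : ℝ) + 1 = p * (1 + 1 / p) := by field_simp
    rw [this, mul_pow, Real.exp_add, mul_comm]
    gcongr
    · calc (1 + 1 / (p : ℝ)) ^ s ≤ Real.exp (1 / p) ^ s := by
            gcongr
            rw [add_comm]; exact Real.add_one_le_exp _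
        _ = Real.exp (s * (1 / p)) := by rw [Real.exp_nat_mul]
        _ ≤ Real.exp 1 := by
            apply Real.exp_le_exp.2
            rw [mul_one_div, div_le_one (by linarith)]
            exact hsp1
    · rw [Real.exp_nat_mul, Real.exp_log (by linarith)]
  have b2 : Real.sqrt 5 ≤ Real.exp 1 := by
    rw [Real.sqrt_le_left (Real.exp_pos _).le]
    have := Real.exp_one_gt_d9
    nlinarith
  have b3 : Real.exp 0.76 ≤ 2.2 := by
    have : Real.exp 0.76 ^ 25 ≤ 2.2 ^ 25 := by
      rw [← Real.exp_nat_mul]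
      have e : ((25 : ℕ) : ℝ) * 0.76 = ((19 : ℕ) : ℝ) * 1 := by norm_num
      rw [e, Real.exp_nat_mul]
      calc Real.exp 1 ^ 19 ≤ 2.7182818286 ^ 19 := by
            gcongr
            exact Real.exp_one_lt_d9.le
        _ ≤ _ := by norm_num
    exact le_of_pow_le_pow_left₀ (by norm_num) (by norm_num) this
  have b4 : (2.2 : ℝ) ^ (-((n : ℝ) - s - 1) / 2) ≤ Real.exp (0.76 * (-((n : ℝ) - s - 1) / 2)) := by
    rw [Real.exp_mul]
    apply Real.rpow_le_rpow_of_nonpos (Real.exp_pos _) b3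
    linarith
  calc _ ≤ Real.exp (1 + s * Real.log p) * (Real.exp 1 *
        Real.exp (0.76 * (-((n : ℝ) - s - 1) / 2))) := by gcongr
    _ = Real.exp ((1 + s * Real.log p) + (1 + 0.76 * (-((n : ℝ) - s - 1) / 2))) := by
      rw [← Real.exp_add, ← Real.exp_add]
    _ ≤ _ := by
      apply Real.exp_le_exp.2
      linarith

end Comb

section Prob
variable {n p : ℕ}

/-- objective in Euclidean form -/
def obE (X : Matrix (Fin n) (Fin p) ℝ) (lam : ℝ) (y u : EuclideanSpace ℝ (Fin n))
    (τ : Finset (Fin p)) : ℝ := ‖(Vs X τ u)ᗮ.starProjection y‖ ^ 2 + lam * τ.card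

lemma Vs_mono (X : Matrix (Fin n) (Fin p) ℝ) (u : EuclideanSpace ℝ (Fin n))
    {τ τ' : Finset (Fin p)} (h : τ ⊆ τ') : Vs X τ u ≤ Vs X τ' u :=
  sup_le_sup_right (Sp_mono X h) _

/-- increment space -/
def Rs (X : Matrix (Fin n) (Fin p) ℝ) (u : EuclideanSpace ℝ (Fin n))
    (τ₀ K : Finset (Fin p)) : Submodule ℝ (EuclideanSpace ℝ (Fin n)) :=
  Vs X (K ∪ τ₀) u ⊓ (Vs X τ₀ u)ᗮ

lemma finrank_Rs (X : Matrix (Fin n) (Fin p) ℝ) (u : EuclideanSpace ℝ (Fin n))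
    (τ₀ K : Finset (Fin p)) : Module.finrank ℝ (Rs X u τ₀ K) ≤ K.card := by
  refine finrank_R (Vs X τ₀ u) (Sp X K) _ ?_ _ (finrank_Sp X K)
  unfold Vs
  rw [Sp_union, sup_comm (Sp X K), sup_assoc, sup_assoc, sup_comm (Sp X K)]

lemma tail_scaled (R : Submodule ℝ (EuclideanSpace ℝ (Fin n))) (r : ℕ)
    (hr : Module.finrank ℝ R ≤ r) (a σ : ℝ) (hσ : 0 < σ) :
    ProbabilityTheory.stdGaussian (EuclideanSpace ℝ (Fin n))
      {U | a ≤ σ ^ 2 * ‖R.starProjection U‖ ^ 2} ≤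
      ENNReal.ofReal (Real.sqrt 3 ^ r * Real.exp (-(a / (3 * σ ^ 2)))) := by
  have h := gauss_tail R r hr (a / σ ^ 2)
  have e : -(a / σ ^ 2) / 3 = -(a / (3 * σ ^ 2)) := by field_simp
  rw [e] at h
  refine le_trans (measure_mono ?_) h
  intro U hU
  rw [Set.mem_ofPred_eq] at hU ⊢
  rw [div_le_iff₀ (by positivity)]
  linarith

lemma probA (X : Matrix (Fin n) (Fin p) ℝ) (τ₀ : Finset (Fin p)) (hs : 1 ≤ τ₀.card)
    (m u : EuclideanSpace ℝ (Fin n)) (hm : m ∈ Sp X τ₀) (σ : ℝ) (hσ : 0 < σ) (lam t : ℝ)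
    (ht : 0 < t)
    (hlam : 6 * σ ^ 2 * ((τ₀.card : ℝ) + 1) * Real.log ((p : ℝ) / 2) + n * t ≤ lam) :
    ProbabilityTheory.stdGaussian (EuclideanSpace ℝ (Fin n))
      {U | ∃ τ : Finset (Fin p), τ₀.card < τ.card ∧
        obE X lam (m + σ • U) u τ ≤ obE X lam (m + σ • U) u τ₀} ≤
      ENNReal.ofReal (3 * Real.exp (-((n : ℝ) * t) / (3 * σ ^ 2))) := by
  rcases Nat.lt_or_ge p 2 with hp | hp
  · have : {U : EuclideanSpace ℝ (Fin n) | ∃ τ : Finset (Fin p), τ₀.card < τ.card ∧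
        obE X lam (m + σ • U) u τ ≤ obE X lam (m + σ • U) u τ₀} = ∅ := by
      ext U
      simp only [Set.mem_ofPred_eq, Set.mem_empty_iff_false, iff_false]
      rintro ⟨τ, h, -⟩
      have := Finset.card_le_univ τ
      rw [Fintype.card_fin] at this
      omega
    rw [this]; simp
  set s := τ₀.card with hsdef
  have hp2 : (2 : ℝ) ≤ p := by exact_mod_cast hp
  have hL : 0 ≤ Real.log ((p : ℝ) / 2) := Real.log_nonneg (by linarith)
  have hnt : 0 ≤ (n : ℝ) * t := by positivity
  have hlam0 : 0 ≤ lam := le_trans (by positivity) hlam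
  set c := Real.sqrt 3 * (2 / (p : ℝ)) ^ 2 with hc
  have hc0 : 0 ≤ c := by positivity
  have hsub : {U : EuclideanSpace ℝ (Fin n) | ∃ τ : Finset (Fin p), s < τ.card ∧
        obE X lam (m + σ • U) u τ ≤ obE X lam (m + σ • U) u τ₀} ⊆
      ⋃ K ∈ (Finset.univ \ τ₀).powerset.erase ∅,
        {U | (max (K.card - s) 1 : ℕ) * lam ≤ σ ^ 2 * ‖(Rs X u τ₀ K).starProjection U‖ ^ 2} := by
    rintro U ⟨τ, hτ, hbad⟩
    simp only [Set.mem_iUnion]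
    refine ⟨τ \ τ₀, ?_, ?_⟩
    · rw [Finset.mem_erase, Finset.mem_powerset]
      refine ⟨?_, Finset.sdiff_subset_sdiff (Finset.subset_univ _) le_rfl⟩
      intro h
      have := Finset.card_le_card (Finset.sdiff_eq_empty_iff_subset.1 h)
      omega
    · have h1 := caseA_det (Vs X τ₀ u) (Vs X τ u) (Vs X ((τ \ τ₀) ∪ τ₀) u)
        (Vs_mono X u Finset.subset_union_right) (Vs_mono X u (by
          rw [Finset.sdiff_union_self_eq_union]; exact Finset.subset_union_left)) m U
        (Submodule.mem_sup_left hm) σ (lam * τ.card - lam * s) (by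
          unfold obE at hbad; linarith)
      rw [Set.mem_ofPred_eq]
      refine le_trans ?_ h1
      have hk : (τ \ τ₀).card ≤ τ.card := Finset.card_le_card Finset.sdiff_subset
      have h2 : max ((τ \ τ₀).card - s) 1 + s ≤ τ.card := by omega
      have h3 : ((max ((τ \ τ₀).card - s) 1 : ℕ) : ℝ) + s ≤ τ.card := by exact_mod_cast h2
      nlinarith
  refine (measure_mono hsub).trans ((measure_biUnion_finset_le _ _).trans ?_)
  have hK : ∀ K ∈ (Finset.univ \ τ₀).powerset.erase ∅,
      ProbabilityTheory.stdGaussian (EuclideanSpace ℝ (Fin n))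
      {U | (max (K.card - s) 1 : ℕ) * lam ≤ σ ^ 2 * ‖(Rs X u τ₀ K).starProjection U‖ ^ 2} ≤
      ENNReal.ofReal (c ^ K.card * Real.exp (-((n : ℝ) * t) / (3 * σ ^ 2))) := by
    intro K _
    refine (tail_scaled _ _ (finrank_Rs X u τ₀ K) _ σ hσ).trans ?_
    apply ENNReal.ofReal_le_ofReal
    set mk := max (K.card - s) 1 with hmk
    have h1 : K.card ≤ mk * (s + 1) := by
      rcases Nat.lt_or_ge K.card (s + 2) with h | h
      · calc K.card ≤ 1 * (s + 1) := by omega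
          _ ≤ _ := Nat.mul_le_mul_right _ (le_max_right _ _)
      · have h2 : K.card - s ≤ mk := le_max_left _ _
        obtain ⟨e, he⟩ := Nat.exists_eq_add_of_le h
        have h3 : e + 2 ≤ mk := by omega
        rw [he]
        nlinarith
    have h1' : (K.card : ℝ) ≤ mk * (s + 1) := by exact_mod_cast h1
    have hmk1 : (1 : ℝ) ≤ mk := by
      have : 1 ≤ mk := le_max_right _ _
      exact_mod_cast this
    rw [hc, mul_pow, mul_assoc]
    gcongr
    have e1 : ((2 / (p : ℝ)) ^ 2) ^ K.card = Real.exp (-(2 * K.card * Real.log ((p : ℝ) / 2))) := by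
      rw [← pow_mul, Real.exp_neg, show (2 * (K.card : ℝ)) = ((2 * K.card : ℕ) : ℝ) by push_cast; ring,
        Real.exp_nat_mul, Real.exp_log (by linarith), ← inv_pow, inv_div]
    rw [e1, ← Real.exp_add]
    apply Real.exp_le_exp.2
    have h4 : (2 * K.card * Real.log ((p : ℝ) / 2)) + (n * t) / (3 * σ ^ 2) ≤
        mk * lam / (3 * σ ^ 2) := by
      have hσ2 : 0 < 3 * σ ^ 2 := by positivity
      rw [le_div_iff₀ hσ2, add_mul, div_mul_cancel₀ _ hσ2.ne']
      have h5 : (K.card : ℝ) * (6 * σ ^ 2 * Real.log ((p : ℝ) / 2)) ≤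
        (mk * (s + 1)) * (6 * σ ^ 2 * Real.log ((p : ℝ) / 2)) :=
        mul_le_mul_of_nonneg_right h1' (by positivity)
      have h6 : mk * (6 * σ ^ 2 * ((s : ℝ) + 1) * Real.log ((p : ℝ) / 2) + n * t) ≤ mk * lam :=
        mul_le_mul_of_nonneg_left hlam (by linarith)
      nlinarith
    rw [neg_div]
    linarith
  refine (Finset.sum_le_sum hK).trans ?_
  rw [← ENNReal.ofReal_sum_of_nonneg (fun K _ => by positivity), ← Finset.sum_mul, sum_K]
  apply ENNReal.ofReal_le_ofReal
  gcongr
  have h1 := num_A p hp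
  have h2 : (1 + c) ^ (p - s) ≤ (1 + c) ^ (p - 1) :=
    pow_le_pow_right₀ (by linarith) (by omega)
  linarith

lemma probB (X : Matrix (Fin n) (Fin p) ℝ) (τ₀ : Finset (Fin p)) (hs : 1 ≤ τ₀.card)
    (m u : EuclideanSpace ℝ (Fin n)) (hm : m ∈ Sp X τ₀) (σ : ℝ) (hσ : 0 < σ) (lam C : ℝ)
    (hC : 0 < C) (hn : 0 < n) (hlam : lam ≤ 0.05 * (n * C))
    (hCb : 120 * (((τ₀.card : ℝ) + 2) * Real.log ((p : ℝ) + 1)) * σ ^ 2 < n * C)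
    (hsep : ∀ τ : Finset (Fin p), τ ≠ τ₀ → τ.card ≤ τ₀.card →
      n * (τ₀ \ τ).card * C ≤ ‖(Sp X τ)ᗮ.starProjection m‖ ^ 2)
    (hG : ∀ τ : Finset (Fin p), τ ≠ τ₀ → τ.card ≤ τ₀.card →
      (inner ℝ ((Sp X τ)ᗮ.starProjection m) u) ^ 2 ≤
      0.6 * ‖(Sp X τ)ᗮ.starProjection m‖ ^ 2 * ‖(Sp X τ)ᗮ.starProjection u‖ ^ 2) :
    ProbabilityTheory.stdGaussian (EuclideanSpace ℝ (Fin n))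
      {U | ∃ τ : Finset (Fin p), τ ≠ τ₀ ∧ τ.card ≤ τ₀.card ∧
        obE X lam (m + σ • U) u τ ≤ obE X lam (m + σ • U) u τ₀} ≤
      ENNReal.ofReal (6 * ((p : ℝ) + 1) ^ 2 * Real.exp (-(n * C / (60 * σ ^ 2)))) := by
  set s := τ₀.card with hsdef
  have hn' : (0 : ℝ) < n := by exact_mod_cast hn
  set z := Real.exp (-(n * C / (60 * σ ^ 2))) with hz
  set w := Real.sqrt 3 * z with hw
  have hsub : {U : EuclideanSpace ℝ (Fin n) | ∃ τ : Finset (Fin p), τ ≠ τ₀ ∧ τ.card ≤ s ∧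
        obE X lam (m + σ • U) u τ ≤ obE X lam (m + σ • U) u τ₀} ⊆
      ⋃ τ ∈ Finset.univ.filter (fun τ : Finset (Fin p) => τ ≠ τ₀ ∧ τ.card ≤ s),
        ({U | n * (τ₀ \ τ).card * C / 20 ≤ σ ^ 2 *
          ‖(Submodule.span ℝ {(Vs X τ u)ᗮ.starProjection m}).starProjection U‖ ^ 2} ∪
        {U | n * (τ₀ \ τ).card * C / 20 ≤ σ ^ 2 *
          ‖(Rs X u τ₀ (τ \ τ₀)).starProjection U‖ ^ 2}) := by
    rintro U ⟨τ, hne, hc, hbad⟩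
    simp only [Set.mem_iUnion]
    refine ⟨τ, by simp [hne, hc], ?_⟩
    have hpos : (τ₀ \ τ).card ≠ 0 := by
      intro h
      have hsub : τ₀ ⊆ τ := Finset.sdiff_eq_empty_iff_subset.1 (Finset.card_eq_zero.1 h)
      exact hne (Finset.eq_of_subset_of_card_le hsub hc).symm
    have hl1 : (1 : ℝ) ≤ (τ₀ \ τ).card := by exact_mod_cast Nat.one_le_iff_ne_zero.2 hpos
    have hcl : s ≤ (τ₀ \ τ).card + τ.card := by
      have a2 := Finset.card_sdiff_add_card_inter τ₀ τ
      have a3 := Finset.card_le_card (Finset.inter_subset_right (s₁ := τ₀) (s₂ := τ))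
      omega
    have hcl' : (s : ℝ) ≤ (τ₀ \ τ).card + τ.card := by exact_mod_cast hcl
    have hc' : (τ.card : ℝ) ≤ s := by exact_mod_cast hc
    have hgd := good_det (Sp X τ) m u (hG τ hne hc)
    have hsp := hsep τ hne hc
    have hnC : 0 < n * C := by positivity
    have h1 := caseB_det (Vs X τ₀ u) (Vs X τ u) (Vs X ((τ \ τ₀) ∪ τ₀) u)
        (Vs_mono X u Finset.subset_union_right) (Vs_mono X u (by
          rw [Finset.sdiff_union_self_eq_union]; exact Finset.subset_union_left)) m U
        (Submodule.mem_sup_left hm) σ (lam * τ.card - lam * s) (n * (τ₀ \ τ).card * C) hσ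
        (by positivity) (by unfold Vs; linarith) (by
          have : lam * (s - τ.card) ≤ 0.05 * (n * C) * (s - τ.card) :=
            mul_le_mul_of_nonneg_right hlam (by linarith)
          have : 0.05 * (n * C) * (s - τ.card) ≤ 0.05 * (n * C) * (τ₀ \ τ).card :=
            mul_le_mul_of_nonneg_left (by linarith) (by positivity)
          linarith) (by
          unfold obE at hbad; linarith)
    exact h1
  refine (measure_mono hsub).trans ((measure_biUnion_finset_le _ _).trans ?_)
  have hz0 : 0 < z := Real.exp_pos _
  have hw0 : 0 ≤ w := by positivity
  have hτ : ∀ τ ∈ Finset.univ.filter (fun τ : Finset (Fin p) => τ ≠ τ₀ ∧ τ.card ≤ s),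
      ProbabilityTheory.stdGaussian (EuclideanSpace ℝ (Fin n))
        ({U | n * (τ₀ \ τ).card * C / 20 ≤ σ ^ 2 *
          ‖(Submodule.span ℝ {(Vs X τ u)ᗮ.starProjection m}).starProjection U‖ ^ 2} ∪
        {U | n * (τ₀ \ τ).card * C / 20 ≤ σ ^ 2 *
          ‖(Rs X u τ₀ (τ \ τ₀)).starProjection U‖ ^ 2}) ≤
      ENNReal.ofReal (2 * w ^ (τ₀ \ τ).card) := by
    intro τ hτ
    obtain ⟨hne, hc⟩ := (Finset.mem_filter.1 hτ).2
    have hpos : (τ₀ \ τ).card ≠ 0 := by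
      intro h
      have hsub : τ₀ ⊆ τ := Finset.sdiff_eq_empty_iff_subset.1 (Finset.card_eq_zero.1 h)
      exact hne (Finset.eq_of_subset_of_card_le hsub hc).symm
    have hkl : (τ \ τ₀).card ≤ (τ₀ \ τ).card := by
      have a1 := Finset.card_sdiff_add_card_inter τ τ₀
      have a2 := Finset.card_sdiff_add_card_inter τ₀ τ
      rw [Finset.inter_comm] at a2
      omega
    have e : Real.sqrt 3 ^ (τ₀ \ τ).card *
        Real.exp (-(n * (τ₀ \ τ).card * C / 20 / (3 * σ ^ 2))) = w ^ (τ₀ \ τ).card := by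
      rw [hw, hz, mul_pow, ← Real.exp_nat_mul]
      congr 2
      field_simp
      ring
    have t1 := tail_scaled (Submodule.span ℝ {(Vs X τ u)ᗮ.starProjection m}) (τ₀ \ τ).card
      ((finrank_span_le_card _).trans (by
        rw [Set.toFinset_singleton, Finset.card_singleton]; omega)) (n * (τ₀ \ τ).card * C / 20) σ hσ
    have t2 := tail_scaled (Rs X u τ₀ (τ \ τ₀)) (τ₀ \ τ).card
      ((finrank_Rs X u τ₀ _).trans hkl) (n * (τ₀ \ τ).card * C / 20) σ hσ
    rw [e] at t1 t2
    refine (measure_union_le _ _).trans ((add_le_add t1 t2).trans ?_)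
    rw [← ENNReal.ofReal_add (by positivity) (by positivity), two_mul]
  refine (Finset.sum_le_sum hτ).trans ?_
  rw [← ENNReal.ofReal_sum_of_nonneg (fun K _ => by positivity), ← Finset.mul_sum]
  apply ENNReal.ofReal_le_ofReal
  have hsp : s ≤ p := by simpa using Finset.card_le_univ τ₀
  have hzb : z ≤ Real.exp (-(2 * ((s : ℝ) + 2) * Real.log ((p : ℝ) + 1))) := by
    apply Real.exp_le_exp.2
    apply neg_le_neg
    rw [le_div_iff₀ (by positivity)]
    linarith
  obtain ⟨n1, n2⟩ := num_B p s hs hsp z hz0.le hzb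
  have := sum_w p τ₀ w hw0 n1
  linarith

lemma probG (X : Matrix (Fin n) (Fin p) ℝ) (τ₀ : Finset (Fin p)) (hs : 1 ≤ τ₀.card)
    (m : EuclideanSpace ℝ (Fin n))
    (h : (τ₀.card : ℝ) * Real.log p + 2 < 0.23 * n) :
    ProbabilityTheory.stdGaussian (EuclideanSpace ℝ (Fin n))
      {u | ¬ ∀ τ : Finset (Fin p), τ ≠ τ₀ → τ.card ≤ τ₀.card →
      (inner ℝ ((Sp X τ)ᗮ.starProjection m) u) ^ 2 ≤
      0.6 * ‖(Sp X τ)ᗮ.starProjection m‖ ^ 2 * ‖(Sp X τ)ᗮ.starProjection u‖ ^ 2} ≤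
    ENNReal.ofReal (Real.exp (2 + τ₀.card * Real.log p - 0.23 * n)) := by
  set s := τ₀.card with hsdef
  have hsp : s ≤ p := by simpa using Finset.card_le_univ τ₀
  have hsub : {u : EuclideanSpace ℝ (Fin n) | ¬ ∀ τ : Finset (Fin p), τ ≠ τ₀ → τ.card ≤ s →
      (inner ℝ ((Sp X τ)ᗮ.starProjection m) u) ^ 2 ≤
      0.6 * ‖(Sp X τ)ᗮ.starProjection m‖ ^ 2 * ‖(Sp X τ)ᗮ.starProjection u‖ ^ 2} ⊆
      ⋃ τ ∈ Finset.univ.filter (fun τ : Finset (Fin p) => τ.card ≤ s),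
      {u | 0.6 * ‖(Sp X τ)ᗮ.starProjection m‖ ^ 2 *
      ‖(Sp X τ)ᗮ.starProjection u‖ ^ 2 < (inner ℝ ((Sp X τ)ᗮ.starProjection m) u) ^ 2} := by
    intro u hu
    rw [Set.mem_ofPred_eq] at hu
    push Not at hu
    obtain ⟨τ, _, hc, h⟩ := hu
    simp only [Set.mem_iUnion]
    exact ⟨τ, by simp [hc], h⟩
  refine (measure_mono hsub).trans ((measure_biUnion_finset_le _ _).trans ?_)
  refine (Finset.sum_le_sum (fun τ hτ => good_prob (Sp X τ) m s
    ((finrank_Sp X τ).trans (Finset.mem_filter.1 hτ).2))).trans ?_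
  rw [Finset.sum_const, nsmul_eq_mul, finrank_euclideanSpace_fin]
  rw [← ENNReal.ofReal_natCast, ← ENNReal.ofReal_mul (by positivity)]
  apply ENNReal.ofReal_le_ofReal
  refine le_trans ?_ (num_G p s n hs hsp h).2
  gcongr
  exact card_models p s

end Prob

section Final
variable {n p : ℕ}

lemma measurable_objPen (X : Matrix (Fin n) (Fin p) ℝ) (lam : ℝ) (τ : Finset (Fin p)) :
    Measurable (fun z : (Fin n → ℝ) × (Fin n → ℝ) => objPen X lam z.1 z.2 τ) := by
  unfold objPen
  apply Measurable.add_const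
  apply UpperSemicontinuous.measurable
  apply upperSemicontinuous_ciInf
  · intro x
    exact ⟨0, by rintro _ ⟨bs, rfl⟩; simp only [sqnorm_eq]; positivity⟩
  · intro bs
    apply Continuous.upperSemicontinuous
    unfold sqnorm
    fun_prop

/-- bad pairs -/
def NB (X : Matrix (Fin n) (Fin p) ℝ) (lam : ℝ) (τ₀ : Finset (Fin p)) (β₀ : Fin p → ℝ) (σ₀ : ℝ) :
    Set ((Fin n → ℝ) × (Fin n → ℝ)) :=
  {z | ∃ τ : Finset (Fin p), τ ≠ τ₀ ∧ objPen X lam (X.mulVec β₀ + σ₀ • z.1) z.2 τ ≤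
    objPen X lam (X.mulVec β₀ + σ₀ • z.1) z.2 τ₀}

lemma measurable_NB (X : Matrix (Fin n) (Fin p) ℝ) (lam : ℝ) (τ₀ : Finset (Fin p))
    (β₀ : Fin p → ℝ) (σ₀ : ℝ) : MeasurableSet (NB X lam τ₀ β₀ σ₀) := by
  have : NB X lam τ₀ β₀ σ₀ = ⋃ τ : Finset (Fin p), ⋃ _ : τ ≠ τ₀,
      {z | objPen X lam (X.mulVec β₀ + σ₀ • z.1) z.2 τ ≤
        objPen X lam (X.mulVec β₀ + σ₀ • z.1) z.2 τ₀} := by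
    ext z; simp [NB]
  rw [this]
  have hm : ∀ τ, Measurable (fun z : (Fin n → ℝ) × (Fin n → ℝ) =>
      objPen X lam (X.mulVec β₀ + σ₀ • z.1) z.2 τ) := by
    intro τ
    exact (measurable_objPen X lam τ).comp
      (f := fun z : (Fin n → ℝ) × (Fin n → ℝ) => (X.mulVec β₀ + σ₀ • z.1, z.2)) (by fun_prop)
  exact MeasurableSet.iUnion fun τ => MeasurableSet.iUnion fun _ => measurableSet_le (hm τ) (hm τ₀)

/-- good repro vectors -/
def GG (X : Matrix (Fin n) (Fin p) ℝ) (τ₀ : Finset (Fin p)) (m : EuclideanSpace ℝ (Fin n)) :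
    Set (Fin n → ℝ) :=
  {u | ∀ τ : Finset (Fin p), τ ≠ τ₀ → τ.card ≤ τ₀.card →
      (inner ℝ ((Sp X τ)ᗮ.starProjection m) (lp u)) ^ 2 ≤
      0.6 * ‖(Sp X τ)ᗮ.starProjection m‖ ^ 2 * ‖(Sp X τ)ᗮ.starProjection (lp u)‖ ^ 2}

lemma measurable_GG (X : Matrix (Fin n) (Fin p) ℝ) (τ₀ : Finset (Fin p))
    (m : EuclideanSpace ℝ (Fin n)) : MeasurableSet (GG X τ₀ m) := by
  have : GG X τ₀ m = ⋂ τ : Finset (Fin p), ⋂ _ : τ ≠ τ₀, ⋂ _ : τ.card ≤ τ₀.card,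
      {u | (inner ℝ ((Sp X τ)ᗮ.starProjection m) (lp u)) ^ 2 ≤
      0.6 * ‖(Sp X τ)ᗮ.starProjection m‖ ^ 2 * ‖(Sp X τ)ᗮ.starProjection (lp u)‖ ^ 2} := by
    ext z; simp [GG]
  rw [this]
  exact MeasurableSet.iInter fun τ => MeasurableSet.iInter fun _ => MeasurableSet.iInter fun _ =>
    measurableSet_le (by fun_prop) (by fun_prop)

lemma bad_joint (d : ℕ) (N : Set ((Fin n → ℝ) × (Fin n → ℝ))) (hN : MeasurableSet N)
    (G : Set (Fin n → ℝ)) (hG : MeasurableSet G) (q δ : ℝ≥0∞)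
    (hq : stdGaussian n Gᶜ ≤ q) (hδ : ∀ u ∈ G, stdGaussian n {U | (U, u) ∈ N} ≤ δ) :
    jointMeasure n d {ω | ∀ b, ω.2 b ∉ G ∨ (ω.1, ω.2 b) ∈ N} ≤ q ^ d + δ := by
  have hm : MeasurableSet {ω : (Fin n → ℝ) × (Fin d → Fin n → ℝ) |
      ∀ b, ω.2 b ∉ G ∨ (ω.1, ω.2 b) ∈ N} := by
    have : {ω : (Fin n → ℝ) × (Fin d → Fin n → ℝ) | ∀ b, ω.2 b ∉ G ∨ (ω.1, ω.2 b) ∈ N} =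
      ⋂ b, ((fun ω : (Fin n → ℝ) × (Fin d → Fin n → ℝ) => ω.2 b) ⁻¹' Gᶜ) ∪
        ((fun ω : (Fin n → ℝ) × (Fin d → Fin n → ℝ) => (ω.1, ω.2 b)) ⁻¹' N) := by
      ext ω; simp
    rw [this]
    exact MeasurableSet.iInter fun b => (hG.compl.preimage (by fun_prop)).union
      (hN.preimage (by fun_prop))
  unfold jointMeasure
  rw [Measure.prod_apply_symm hm]
  set A : Set (Fin d → Fin n → ℝ) := Set.pi Set.univ (fun _ => Gᶜ) with hA
  have hAm : MeasurableSet A := MeasurableSet.univ_pi fun _ => hG.compl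
  calc _ ≤ ∫⁻ v, (A.indicator 1 v + δ) ∂(Measure.pi fun _ : Fin d => stdGaussian n) := by
        apply lintegral_mono
        intro v
        by_cases hv : v ∈ A
        · simp only [Set.indicator_of_mem hv, Pi.one_apply]
          exact prob_le_one.trans le_self_add
        · simp only [Set.indicator_of_notMem hv, zero_add]
          rw [hA, Set.mem_univ_pi] at hv
          push Not at hv
          obtain ⟨b, hb⟩ := hv
          rw [Set.notMem_compl_iff] at hb
          refine le_trans (measure_mono ?_) (hδ _ hb)
          intro U hU
          have h := (hU : ∀ b, v b ∉ G ∨ (U, v b) ∈ N) b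
          exact h.resolve_left (not_not_intro hb)
    _ = (Measure.pi fun _ : Fin d => stdGaussian n) A + δ := by
        rw [lintegral_add_right _ measurable_const, lintegral_indicator_one hAm]
        simp
    _ ≤ _ := by
        gcongr
        rw [hA, Measure.pi_pi]
        simp only [Finset.prod_const, Finset.card_univ, Fintype.card_fin]
        gcongr

end Final

/-- **Theorem 2.5.** Large-sample (finite-`d`) validity of the repro-samples model
confidence set `Γ̄^τ_α`. -/
theorem model_confidence_set_large_sample {n p : ℕ}
    (X : Matrix (Fin n) (Fin p) ℝ) (τ₀ : Finset (Fin p)) (β₀ : Fin p → ℝ)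
    (hβsupp : ∀ j ∉ τ₀, β₀ j = 0) (hβne : ∀ j ∈ τ₀, β₀ j ≠ 0)
    (σ₀ : ℝ) (hσ₀ : 0 < σ₀)
    (hGram : ∀ τ : Finset (Fin p), τ.card ≤ n →
      IsUnit ((subcols X τ)ᵀ * subcols X τ).det)
    (hid : Identifiable X τ₀ β₀)
    (t : ℝ) (ht : 0 < t) (lam : ℝ)
    (hlam : lam / (n : ℝ) ∈ Set.Icc
      (6 * σ₀ ^ 2 * ((τ₀.card : ℝ) + 1) * Real.log ((p : ℝ)/2) / (n : ℝ) + t)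
      (0.05 * Cmin X τ₀ β₀))
    (hsize : (τ₀.card : ℝ) * Real.log (p : ℝ) / (n : ℝ) < 0.23)
    (hCmin : Cmin X τ₀ β₀ >
      120 * (((τ₀.card : ℝ) + 2) * Real.log ((p : ℝ) + 1) / (n : ℝ)) * σ₀ ^ 2)
    (α : ℝ) (hα : α ∈ Set.Ioo (0 : ℝ) 1)
    (Tt : (Fin n → ℝ) → Finset (Fin p) → Finset (Fin p))
    (hTt : ∀ (y : Fin n → ℝ) (τ : Finset (Fin p)),
      (Tt y τ).card ≤ τ.card ∧
        ∀ τ' : Finset (Fin p), τ'.card ≤ τ.card → rss X y (Tt y τ) ≤ rss X y τ')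
    (tauHat : (Fin n → ℝ) → (Fin n → ℝ) → Finset (Fin p))
    (hmin : ∀ (y ustar : Fin n → ℝ) (τ : Finset (Fin p)),
      objPen X lam y ustar (tauHat y ustar) ≤ objPen X lam y ustar τ)
    (d : ℕ) :
    ENNReal.ofReal (α -
        (6 * Real.exp (-((n : ℝ) / (18 * σ₀ ^ 2)) *
            (0.3 * Cmin X τ₀ β₀ - 36 * (Real.log ((p : ℝ) + 1) / (n : ℝ)) * σ₀ ^ 2)) +
          3 * Real.exp (-((n : ℝ) * t) / (3 * σ₀ ^ 2)) +
          Real.exp (-((n : ℝ) * (d : ℝ)) *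
            (0.23 - ((τ₀.card : ℝ) * Real.log (p : ℝ) + 2) / (n : ℝ))))) ≤
      jointMeasure n d
        {ω | (∃ b : Fin d, tauHat (X.mulVec β₀ + σ₀ • ω.1) (ω.2 b) = τ₀) ∧
          inCS X Tt α (X.mulVec β₀ + σ₀ • ω.1) τ₀} := by
  obtain ⟨hlam1, hlam2⟩ := hlam
  have hn : 0 < n := by
    rcases Nat.eq_zero_or_pos n with h | h
    · subst h
      simp at hlam1
      linarith
    · exact h
  have hn' : (0 : ℝ) < n := by exact_mod_cast hn
  set C := Cmin X τ₀ β₀ with hC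
  have hL : 0 ≤ Real.log ((p : ℝ) + 1) :=
    Real.log_nonneg (by linarith [Nat.cast_nonneg (α := ℝ) p])
  have hC0 : 0 < C := lt_of_le_of_lt (by positivity) hCmin
  have hs : 1 ≤ τ₀.card := by
    by_contra h
    have h0 : τ₀ = ∅ := Finset.card_eq_zero.1 (by omega)
    have : C = 0 := by
      rw [hC, Cmin, h0]
      have : {τ : Finset (Fin p) | τ ≠ ∅ ∧ τ.card ≤ (∅ : Finset (Fin p)).card} = ∅ := by
        ext τ
        simp only [Set.mem_ofPred_eq, Set.mem_empty_iff_false, iff_false, Finset.card_empty]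
        rintro ⟨h1, h2⟩
        exact h1 (Finset.card_eq_zero.1 (by omega))
      rw [this, Set.image_empty, Real.sInf_empty]
    linarith
  set s := τ₀.card with hsdef
  rcases le_or_gt (0.23 * (n : ℝ)) ((s : ℝ) * Real.log p + 2) with htriv | hmain
  · have h1 : 1 ≤ Real.exp (-((n : ℝ) * (d : ℝ)) *
            (0.23 - ((s : ℝ) * Real.log (p : ℝ) + 2) / (n : ℝ))) := by
      rw [Real.one_le_exp_iff]
      apply mul_nonneg_of_nonpos_of_nonpos
      · have : (0 : ℝ) ≤ n * d := by positivity
        linarith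
      · rw [sub_nonpos, le_div_iff₀ hn']; exact htriv
    rw [ENNReal.ofReal_of_nonpos]
    · exact zero_le
    · have := Real.exp_pos (-((n : ℝ) / (18 * σ₀ ^ 2)) *
            (0.3 * C - 36 * (Real.log ((p : ℝ) + 1) / (n : ℝ)) * σ₀ ^ 2))
      have := Real.exp_pos (-((n : ℝ) * t) / (3 * σ₀ ^ 2))
      linarith [hα.2]
  have hsp : s ≤ p := by simpa using Finset.card_le_univ τ₀
  have hsn : s < n := (num_G p s n hs hsp hmain).1
  set m := lp (X.mulVec β₀) with hm
  have hmK : m ∈ Sp X τ₀ := by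
    rw [mem_Sp]
    refine ⟨β₀, ?_⟩
    congr 2
    ext j
    unfold maskOn
    split_ifs with h
    · rfl
    · exact (hβsupp j h).symm
  -- separation
  have hsep : ∀ τ : Finset (Fin p), τ ≠ τ₀ → τ.card ≤ τ₀.card →
      n * (τ₀ \ τ).card * C ≤ ‖(Sp X τ)ᗮ.starProjection m‖ ^ 2 := by
    intro τ hne hc
    have h1 : C ≤ sqnorm ((1 - proj X τ).mulVec (X.mulVec β₀)) /
        ((n * max (τ₀ \ τ).card 1 : ℕ) : ℝ) := by
      apply csInf_le
      · exact (Set.toFinite _).bddBelow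
      · exact ⟨τ, ⟨hne, hc⟩, rfl⟩
    rw [sqnorm_eq, proj_eq' X τ (hGram τ (by omega))] at h1
    have hmx : 0 < n * max (τ₀ \ τ).card 1 := Nat.mul_pos hn (by omega)
    rw [le_div_iff₀ (by exact_mod_cast hmx)] at h1
    refine le_trans ?_ h1
    push_cast
    have : ((τ₀ \ τ).card : ℝ) ≤ max ((τ₀ \ τ).card : ℝ) 1 := le_max_left _ _
    have h2 : (n * C) * ((τ₀ \ τ).card : ℝ) ≤ (n * C) * max ((τ₀ \ τ).card : ℝ) 1 :=
      mul_le_mul_of_nonneg_left this (by positivity)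
    linarith
  have hlamA : 6 * σ₀ ^ 2 * ((s : ℝ) + 1) * Real.log ((p : ℝ) / 2) + n * t ≤ lam := by
    rw [le_div_iff₀ hn', add_mul, div_mul_cancel₀ _ hn'.ne'] at hlam1
    linarith
  have hlamB : lam ≤ 0.05 * (n * C) := by
    rw [div_le_iff₀ hn'] at hlam2
    linarith
  have hCb : 120 * (((s : ℝ) + 2) * Real.log ((p : ℝ) + 1)) * σ₀ ^ 2 < n * C := by
    have h1 : n * (120 * (((s : ℝ) + 2) * Real.log ((p : ℝ) + 1) / (n : ℝ)) * σ₀ ^ 2) < n * C :=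
      mul_lt_mul_of_pos_left hCmin hn'
    refine lt_of_eq_of_lt ?_ h1
    field_simp
  set δ1 := 6 * Real.exp (-((n : ℝ) / (18 * σ₀ ^ 2)) *
            (0.3 * C - 36 * (Real.log ((p : ℝ) + 1) / (n : ℝ)) * σ₀ ^ 2)) with hδ1
  set δ2 := 3 * Real.exp (-((n : ℝ) * t) / (3 * σ₀ ^ 2)) with hδ2
  set q := Real.exp (2 + s * Real.log p - 0.23 * n) with hq
  have e3 : Real.exp (-((n : ℝ) * (d : ℝ)) *
            (0.23 - ((s : ℝ) * Real.log (p : ℝ) + 2) / (n : ℝ))) = q ^ d := by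
    rw [hq, ← Real.exp_nat_mul]
    congr 1
    field_simp
    ring
  have e1 : 6 * ((p : ℝ) + 1) ^ 2 * Real.exp (-(n * C / (60 * σ₀ ^ 2))) = δ1 := by
    have hp1 : (0 : ℝ) < (p : ℝ) + 1 := by positivity
    have : ((p : ℝ) + 1) ^ 2 = Real.exp (2 * Real.log ((p : ℝ) + 1)) := by
      rw [show (2 : ℝ) = ((2 : ℕ) : ℝ) by norm_num, Real.exp_nat_mul, Real.exp_log hp1]
    rw [hδ1, this, mul_assoc, ← Real.exp_add]
    congr 2
    field_simp
    ring
  have hδ10 : 0 ≤ δ1 := by positivity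
  have hδ20 : 0 ≤ δ2 := by positivity
  have hq0 : 0 ≤ q := (Real.exp_pos _).le
  rw [e3]
  set N := NB X lam τ₀ β₀ σ₀ with hN
  set G := GG X τ₀ m with hG
  set E2 := {U | inCS X Tt α (X.mulVec β₀ + σ₀ • U) τ₀} with hE2
  have hI : ENNReal.ofReal α ≤ stdGaussian n E2 :=
    partI X τ₀ β₀ hβsupp σ₀ hσ₀ (hGram τ₀ hsn.le) hsn α hα Tt
  have hGp : stdGaussian n Gᶜ ≤ ENNReal.ofReal q := by
    have := probG X τ₀ hs m hmain
    rw [← stdG_apply] at this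
    exact this
  have hNp : ∀ u ∈ G, stdGaussian n {U | (U, u) ∈ N} ≤ ENNReal.ofReal (δ1 + δ2) := by
    intro u hu
    have hA := probA X τ₀ hs m (lp u) hmK σ₀ hσ₀ lam t ht hlamA
    have hB := probB X τ₀ hs m (lp u) hmK σ₀ hσ₀ lam C hC0 hn hlamB hCb hsep hu
    rw [← stdG_apply] at hA hB
    rw [e1] at hB
    rw [ENNReal.ofReal_add hδ10 hδ20]
    refine le_trans (measure_mono ?_) ((measure_union_le _ _).trans (add_le_add hB hA))
    rintro U ⟨τ, hne, hle⟩
    have hlpu : lp (X.mulVec β₀ + σ₀ • U) = m + σ₀ • lp U := by simp [hm, lp]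
    simp only [objPen_eq, hlpu] at hle
    rcases le_or_gt τ.card τ₀.card with hc | hc
    · left; exact ⟨τ, hne, hc, hle⟩
    · right; exact ⟨τ, hc, hle⟩
  have hbad := bad_joint d N (measurable_NB _ _ _ _ _) G (measurable_GG _ _ _) _ _ hGp hNp
  set Bad := {ω : (Fin n → ℝ) × (Fin d → Fin n → ℝ) | ∀ b, ω.2 b ∉ G ∨ (ω.1, ω.2 b) ∈ N}
  set J := {ω : (Fin n → ℝ) × (Fin d → Fin n → ℝ) |
    (∃ b : Fin d, tauHat (X.mulVec β₀ + σ₀ • ω.1) (ω.2 b) = τ₀) ∧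
          inCS X Tt α (X.mulVec β₀ + σ₀ • ω.1) τ₀} with hJ
  have hcov : E2 ×ˢ (Set.univ : Set (Fin d → Fin n → ℝ)) ⊆ J ∪ Bad := by
    rintro ω ⟨h1, -⟩
    by_cases hb : ω ∈ Bad
    · exact Or.inr hb
    · left
      have hb' : ¬ ∀ b, ω.2 b ∉ G ∨ (ω.1, ω.2 b) ∈ N := hb
      push Not at hb'
      obtain ⟨b, -, hb2⟩ := hb'
      refine ⟨⟨b, ?_⟩, h1⟩
      by_contra hne
      exact hb2 ⟨_, hne, hmin _ _ _⟩
  have htot : ENNReal.ofReal α ≤ jointMeasure n d J + ENNReal.ofReal (δ1 + δ2 + q ^ d) := by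
    calc ENNReal.ofReal α ≤ stdGaussian n E2 := hI
      _ = jointMeasure n d (E2 ×ˢ (Set.univ : Set (Fin d → Fin n → ℝ))) := by
          unfold jointMeasure
          rw [Measure.prod_prod, measure_univ, mul_one]
      _ ≤ jointMeasure n d J + jointMeasure n d Bad :=
          (measure_mono hcov).trans (measure_union_le _ _)
      _ ≤ _ := by
          gcongr
          refine hbad.trans (le_of_eq ?_)
          rw [ENNReal.ofReal_add (add_nonneg hδ10 hδ20) (pow_nonneg hq0 d), ENNReal.ofReal_pow hq0, add_comm]
  rw [ENNReal.ofReal_sub _ (by positivity)]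
  exact tsub_le_iff_right.2 htot

end ReproSamples
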